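/- Let d ≥ 1 and let ψ : ℝ^d → ℝ be smooth, compactly supported, radial, nonnegative, with ∫ ψ = 1; set ψ_r(x) := r^{−d} ψ(x/r). Let f : ℝ^d → ℝ be continuously differentiable with ‖∇f‖_* ≤ M, where ‖∇f‖_* := sup_{x, r} ⨍_{B_r(x)} |∇f(y) − ⨍_{B_r(x)} ∇f| dy. Then there is a constant C depending only on d and ψ such that for every z ∈ ℝ^d and R > 0, ∫_0^R ∫_{B_R(z)} ν̄₁^f(x,r)² dx dr/r ≤ C M² R^d. -/

import Mathlib

open MeasureTheory Metric RealInnerProductSpace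

/-- The mollification `(f ∗ ψ_r)(x)` where `ψ_r(x) = r^{−d} ψ(x/r)`. -/
noncomputable def mollify (d : ℕ) (ψ f : EuclideanSpace ℝ (Fin d) → ℝ) (r : ℝ)
    (x : EuclideanSpace ℝ (Fin d)) : ℝ :=
  ∫ y, f y * (r ^ (-(d : ℝ)) * ψ (r⁻¹ • (x - y)))

/-- `ν̄₁^f(x,r)`: the normalized `L²` mean over `B_r(x)` of the deviation of `f` from the
approximate first-order Taylor polynomial `(f∗ψ_r)(x) + ∇(f∗ψ_r)(x)·(y−x)`. -/
noncomputable def nu1bar (d : ℕ) (ψ f : EuclideanSpace ℝ (Fin d) → ℝ)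
    (x : EuclideanSpace ℝ (Fin d)) (r : ℝ) : ℝ :=
  Real.sqrt (⨍ y in ball x r,
    ((f y - mollify d ψ f r x - ⟪gradient (mollify d ψ f r) x, y - x⟫) / r) ^ 2)

/-- The half-open axis-parallel cube with lower corner `a` and side length `s`. -/
def cube {d : ℕ} (a : EuclideanSpace ℝ (Fin d)) (s : ℝ) : Set (EuclideanSpace ℝ (Fin d)) :=
  {x | ∀ i, a i ≤ x i ∧ x i < a i + s}

/-- The lower corners of the `2 ^ d` dyadic children of `cube a s`. -/
noncomputable def childCorner {d : ℕ} (a : EuclideanSpace ℝ (Fin d)) (s : ℝ) (ε : Fin d → Bool) :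
    EuclideanSpace ℝ (Fin d) :=
  WithLp.toLp 2 fun i => a i + if ε i then s / 2 else 0

theorem cube_eq_preimage {d : ℕ} (a : EuclideanSpace ℝ (Fin d)) (s : ℝ) :
    cube a s = (WithLp.ofLp : EuclideanSpace ℝ (Fin d) → Fin d → ℝ) ⁻¹'
      Set.univ.pi fun i => Set.Ico (a i) (a i + s) := by
  ext x; simp [cube]

theorem measurableSet_cube {d : ℕ} (a : EuclideanSpace ℝ (Fin d)) (s : ℝ) :
    MeasurableSet (cube a s) := by
  rw [cube_eq_preimage]
  exact (PiLp.volume_preserving_ofLp (Fin d)).measurable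
    (MeasurableSet.univ_pi fun _ => measurableSet_Ico)

theorem volume_real_cube {d : ℕ} (a : EuclideanSpace ℝ (Fin d)) {s : ℝ} (hs : 0 ≤ s) :
    volume.real (cube a s) = s ^ d := by
  rw [cube_eq_preimage, measureReal_def, (PiLp.volume_preserving_ofLp (Fin d)).measure_preimage
    (MeasurableSet.univ_pi fun _ => measurableSet_Ico).nullMeasurableSet, Real.volume_pi_Ico]
  simp [hs]

theorem cube_subset_closedBall {d : ℕ} (a : EuclideanSpace ℝ (Fin d)) {s : ℝ} :
    cube a s ⊆ closedBall a (d * s) := by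
  intro x hx
  rw [mem_closedBall, dist_eq_norm, EuclideanSpace.norm_eq]
  refine (Real.sqrt_le_sqrt (Finset.sum_le_sum fun i _ => (?_ : _ ≤ s ^ 2))).trans ?_
  · have := hx i
    rw [Real.norm_eq_abs, sq_abs]
    simp only [PiLp.sub_apply]
    nlinarith
  · rcases Nat.eq_zero_or_pos d with rfl | hd
    · simp
    have hs : 0 ≤ s := by have := hx ⟨0, hd⟩; linarith
    have h1 : (1 : ℝ) ≤ d := by exact_mod_cast hd
    apply Real.sqrt_le_iff.2 ⟨by positivity, ?_⟩
    simp only [Finset.sum_const, Finset.card_univ, Fintype.card_fin, nsmul_eq_mul]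
    nlinarith [mul_nonneg (mul_nonneg (by linarith : (0:ℝ) ≤ (d:ℝ)) (sub_nonneg.2 h1))
      (sq_nonneg s)]

theorem ball_subset_cube {d : ℕ} (z : EuclideanSpace ℝ (Fin d)) (r : ℝ) :
    ball z r ⊆ cube (WithLp.toLp 2 fun i => z i - r) (2 * r) := by
  intro x hx i
  have h := (PiLp.norm_apply_le (x - z) i).trans_lt (mem_ball_iff_norm.1 hx)
  rw [Real.norm_eq_abs, abs_lt] at h
  simp only [PiLp.sub_apply] at h ⊢
  constructor <;> linarith

theorem cube_eq_iUnion_children {d : ℕ} (a : EuclideanSpace ℝ (Fin d)) (s : ℝ) :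
    cube a s = ⋃ ε : Fin d → Bool, cube (childCorner a s ε) (s / 2) := by
  ext x
  simp only [Set.mem_iUnion]
  constructor
  · intro hx
    refine ⟨fun i => decide (a i + s / 2 ≤ x i), fun i => ?_⟩
    have := hx i
    by_cases h : a i + s / 2 ≤ x i
    · simp only [childCorner, decide_eq_true h, if_true]
      constructor <;> linarith
    · simp only [childCorner, decide_eq_false h, Bool.false_eq_true, if_false]
      constructor <;> linarith
  · rintro ⟨ε, h⟩ i
    have := h i
    rcases hε : ε i <;> simp only [childCorner, hε, if_true, Bool.false_eq_true,
      if_false] at this <;>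
      constructor <;> linarith

theorem pairwise_disjoint_children {d : ℕ} (a : EuclideanSpace ℝ (Fin d)) (s : ℝ) :
    Pairwise (Function.onFun Disjoint fun ε : Fin d → Bool =>
      cube (childCorner a s ε) (s / 2)) := by
  intro ε ε' hne
  refine Set.disjoint_left.2 fun x hx hx' => hne (funext fun i => ?_)
  have h := hx i
  have h' := hx' i
  rcases hε : ε i <;> rcases hε' : ε' i <;>
    simp only [childCorner, hε, hε', if_true, Bool.false_eq_true, if_false] at h h' <;>
    first | rfl | (exfalso; linarith)

theorem Continuous.integrableOn_of_isBounded {d : ℕ} {g : EuclideanSpace ℝ (Fin d) → ℝ}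
    (hg : Continuous g) {A : Set (EuclideanSpace ℝ (Fin d))} (hA : Bornology.IsBounded A) :
    IntegrableOn g A :=
  (hg.continuousOn.integrableOn_compact hA.isCompact_closure).mono_set subset_closure

theorem Continuous.integrableOn_cube {d : ℕ} {g : EuclideanSpace ℝ (Fin d) → ℝ}
    (hg : Continuous g) (a : EuclideanSpace ℝ (Fin d)) (s : ℝ) : IntegrableOn g (cube a s) :=
  hg.integrableOn_of_isBounded (isBounded_closedBall.subset (cube_subset_closedBall a))

theorem integral_cube_eq_sum_children {d : ℕ} {g : EuclideanSpace ℝ (Fin d) → ℝ}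
    (hg : Continuous g) (a : EuclideanSpace ℝ (Fin d)) (s : ℝ) :
    ∫ x in cube a s, g x = ∑ ε : Fin d → Bool, ∫ x in cube (childCorner a s ε) (s / 2), g x := by
  rw [cube_eq_iUnion_children a s]
  exact integral_iUnion_fintype (fun _ => measurableSet_cube _ _) (pairwise_disjoint_children a s)
    fun _ => hg.integrableOn_cube _ _

/-- The Calderón–Zygmund stopping argument behind the John–Nirenberg inequality. -/
theorem integral_cube_sq_le_of_stopping {d : ℕ} {F : Type*} [NormedAddCommGroup F]
    {G : EuclideanSpace ℝ (Fin d) → F} (hG : Continuous G)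
    {c : EuclideanSpace ℝ (Fin d) → ℝ → F} {l S δ : ℝ} (hl : 0 < l) (hS0 : 0 ≤ S)
    {Q : Set (EuclideanSpace ℝ (Fin d))}
    (hc : ∀ a s, 0 < s → ∫ x in cube a s, ‖G x - c a s‖ ≤ l * s ^ d)
    (hS : ∀ a s, 0 < s → cube a s ⊆ Q → ∫ x in cube a s, ‖G x - c a s‖ ^ 2 ≤ S * s ^ d)
    (hδ : ∀ x ∈ Q, ∀ y ∈ Q, dist x y ≤ δ → ‖G x - G y‖ ≤ l) (c₀ : F) (n : ℕ) :
    ∀ a s, 0 < s → cube a s ⊆ Q → 2 * (d * s) ≤ 2 ^ n * δ →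
      ∫ x in cube a s, ‖G x - c₀‖ ≤ l * s ^ d →
      ∫ x in cube a s, ‖G x - c₀‖ ^ 2 ≤ 4 * l ^ 2 * s ^ d +
        (2 * S + 2 * ((1 + 2 ^ d) * l) ^ 2) / l * ∫ x in cube a s, ‖G x - c₀‖ := by
  have hcont : ∀ b : F, Continuous fun x => ‖G x - b‖ := fun b => by fun_prop
  set K := (2 * S + 2 * ((1 + 2 ^ d) * l) ^ 2) / l with hK
  have hK0 : 0 ≤ K := by positivity
  induction n with
  | zero =>
    intro a s hs haQ hsδ h1
    have hpt : ∀ x ∈ cube a s, ‖G x - c₀‖ ≤ 2 * l := by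
      intro x hx
      have h2 : ∫ y in cube a s, (‖G x - c₀‖ - l) ≤ ∫ y in cube a s, ‖G y - c₀‖ := by
        refine setIntegral_mono_on ((continuous_const).integrableOn_cube a s)
          ((hcont c₀).integrableOn_cube a s) (measurableSet_cube a s) fun y hy => ?_
        have h3 : dist x y ≤ δ := by
          have := dist_triangle_right x y a
          have h4 := mem_closedBall.1 (cube_subset_closedBall a hx)
          have h5 := mem_closedBall.1 (cube_subset_closedBall a hy)
          linarith
        have h6 := hδ x (haQ hx) y (haQ hy) h3
        have h7 := norm_sub_le_norm_sub_add_norm_sub (G x) (G y) c₀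
        linarith
      rw [setIntegral_const, volume_real_cube a hs.le, smul_eq_mul] at h2
      have h3 : 0 < s ^ d := by positivity
      nlinarith
    have h2 : ∫ x in cube a s, ‖G x - c₀‖ ^ 2 ≤ ∫ x in cube a s, 4 * l ^ 2 := by
      refine setIntegral_mono_on (((hcont c₀).pow 2).integrableOn_cube a s)
        ((continuous_const).integrableOn_cube a s) (measurableSet_cube a s) fun y hy => ?_
      nlinarith [hpt y hy, norm_nonneg (G y - c₀)]
    rw [setIntegral_const, volume_real_cube a hs.le, smul_eq_mul] at h2
    have h3 : 0 ≤ ∫ x in cube a s, ‖G x - c₀‖ := integral_nonneg fun _ => norm_nonneg _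
    nlinarith [mul_nonneg hK0 h3]
  | succ n ih =>
    intro a s hs haQ hsδ h1
    have hsd : s ^ d = 2 ^ d * (s / 2) ^ d := by rw [← mul_pow]; congr 1; ring
    have hvol : s ^ d = ∑ ε : Fin d → Bool, (s / 2) ^ d := by
      simp [hsd]
    have h1' : ∀ b : Fin d → Bool, ∫ x in cube (childCorner a s b) (s / 2), ‖G x - c₀‖ ≤
        l * 2 ^ d * (s / 2) ^ d := by
      intro b
      rw [mul_assoc, ← hsd]
      refine le_trans ?_ h1
      rw [integral_cube_eq_sum_children (hcont c₀) a s]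
      exact Finset.single_le_sum (f := fun b => ∫ x in cube (childCorner a s b) (s / 2), ‖G x - c₀‖)
        (fun _ _ => integral_nonneg fun _ => norm_nonneg _) (Finset.mem_univ b)
    rw [integral_cube_eq_sum_children (hcont c₀) a s,
      integral_cube_eq_sum_children (g := fun x => ‖G x - c₀‖ ^ 2) ((hcont c₀).pow 2) a s, hvol,
      Finset.mul_sum,
      Finset.mul_sum, ← Finset.sum_add_distrib]
    refine Finset.sum_le_sum fun b _ => ?_
    have hsub : cube (childCorner a s b) (s / 2) ⊆ Q := by
      refine Set.Subset.trans ?_ haQ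
      rw [cube_eq_iUnion_children a s]
      exact Set.subset_iUnion (fun b => cube (childCorner a s b) (s / 2)) b
    have hs2 : 0 < s / 2 := by positivity
    set P := cube (childCorner a s b) (s / 2) with hP
    by_cases hb : ∫ x in P, ‖G x - c₀‖ ≤ l * (s / 2) ^ d
    · refine ih _ _ hs2 hsub ?_ hb
      rw [pow_succ] at hsδ
      linarith
    · push Not at hb
      set e := c (childCorner a s b) (s / 2) with he
      have hv : 0 < (s / 2) ^ d := by positivity
      have h2 : ‖e - c₀‖ ≤ (1 + 2 ^ d) * l := by
        have h3 : ∫ x in P, ‖e - c₀‖ ≤ ∫ x in P, (‖G x - e‖ + ‖G x - c₀‖) := by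
          refine setIntegral_mono_on ((continuous_const).integrableOn_cube _ _)
            (((hcont e).add (hcont c₀)).integrableOn_cube _ _) (measurableSet_cube _ _)
            fun y _ => ?_
          rw [norm_sub_rev (G y) e]
          exact norm_sub_le_norm_sub_add_norm_sub _ _ _
        rw [setIntegral_const, volume_real_cube _ hs2.le, smul_eq_mul,
          integral_add ((hcont e).integrableOn_cube _ _) ((hcont c₀).integrableOn_cube _ _)] at h3
        have h4 := hc (childCorner a s b) (s / 2) hs2
        have h5 := h1' b
        rw [← hP, ← he] at h4
        nlinarith
      have h6 : ∫ x in P, ‖G x - c₀‖ ^ 2 ≤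
          ∫ x in P, (2 * ‖G x - e‖ ^ 2 + 2 * ((1 + 2 ^ d) * l) ^ 2) := by
        refine setIntegral_mono_on (((hcont c₀).pow 2).integrableOn_cube _ _)
          (Continuous.integrableOn_cube (by fun_prop) _ _) (measurableSet_cube _ _) fun y _ => ?_
        have h7 := norm_sub_le_norm_sub_add_norm_sub (G y) e c₀
        have h8 : ‖G y - c₀‖ ≤ ‖G y - e‖ + (1 + 2 ^ d) * l := by linarith
        have h9 := pow_le_pow_left₀ (norm_nonneg _) h8 2
        nlinarith [sq_nonneg (‖G y - e‖ - (1 + 2 ^ d) * l)]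
      rw [integral_add (Continuous.integrableOn_cube (by fun_prop) _ _)
        (Continuous.integrableOn_cube (by fun_prop) _ _), integral_const_mul, setIntegral_const,
        volume_real_cube _ hs2.le, smul_eq_mul] at h6
      have h7 := hS _ _ hs2 hsub
      rw [← hP, ← he] at h7
      have h8 : K * (l * (s / 2) ^ d) ≤ K * ∫ x in P, ‖G x - c₀‖ := by gcongr
      have h9 : K * (l * (s / 2) ^ d) = (2 * S + 2 * ((1 + 2 ^ d) * l) ^ 2) * (s / 2) ^ d := by
        rw [hK]; field_simp
      have h10 : 0 ≤ 4 * l ^ 2 * (s / 2) ^ d := by positivity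
      linarith

/-- The `L²` form of the John–Nirenberg inequality on cubes, for continuous functions. -/
theorem integral_cube_sq_le_of_integral_cube_le {d : ℕ} {F : Type*} [NormedAddCommGroup F]
    {G : EuclideanSpace ℝ (Fin d) → F} (hG : Continuous G)
    {c : EuclideanSpace ℝ (Fin d) → ℝ → F} {M : ℝ} (hM : 0 < M)
    (hc : ∀ a s, 0 < s → ∫ x in cube a s, ‖G x - c a s‖ ≤ M * s ^ d)
    (a₀ : EuclideanSpace ℝ (Fin d)) {s₀ : ℝ} (hs₀ : 0 < s₀) :
    ∫ x in cube a₀ s₀, ‖G x - c a₀ s₀‖ ^ 2 ≤ (128 + 16 * (1 + 2 ^ d) ^ 2) * M ^ 2 * s₀ ^ d := by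
  have hcont : ∀ b : F, Continuous fun x => ‖G x - b‖ := fun b => by fun_prop
  set K : ℝ := (128 + 16 * (1 + 2 ^ d) ^ 2) * M ^ 2 with hK
  have hK0 : 0 < K := by positivity
  obtain ⟨B, hB⟩ := (isCompact_closedBall a₀ (d * s₀)).exists_bound_of_continuousOn
    hG.continuousOn
  have hQ := cube_subset_closedBall a₀ (s := s₀)
  have huc := (isCompact_closedBall a₀ (d * s₀)).uniformContinuousOn_of_continuous
    hG.continuousOn
  obtain ⟨δ, hδ0, hδ⟩ := Metric.uniformContinuousOn_iff_le.1 huc (4 * M) (by positivity)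
  have hmain : ∀ n : ℕ, ∀ a s, 0 < s → cube a s ⊆ cube a₀ s₀ →
      ∫ x in cube a s, ‖G x - c a s‖ ^ 2 ≤ ((2 * B + M) ^ 2 / 2 ^ n + K) * s ^ d := by
    intro n
    induction n with
    | zero =>
      intro a s hs ha
      have hsd : 0 < s ^ d := by positivity
      have hpt : ∀ x ∈ cube a s, ‖G x - c a s‖ ≤ 2 * B + M := by
        intro x hx
        have h2 : ∫ y in cube a s, (‖G x - c a s‖ - 2 * B) ≤ ∫ y in cube a s, ‖G y - c a s‖ := by
          refine setIntegral_mono_on ((continuous_const).integrableOn_cube a s)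
            ((hcont _).integrableOn_cube a s) (measurableSet_cube a s) fun y hy => ?_
          have h6 := hB x (hQ (ha hx))
          have h6' := hB y (hQ (ha hy))
          have h7 := norm_sub_le_norm_sub_add_norm_sub (G x) (G y) (c a s)
          have h8 := norm_sub_le (G x) (G y)
          linarith
        rw [setIntegral_const, volume_real_cube a hs.le, smul_eq_mul] at h2
        have := hc a s hs
        nlinarith
      have h2 : ∫ x in cube a s, ‖G x - c a s‖ ^ 2 ≤ ∫ x in cube a s, (2 * B + M) ^ 2 := by
        refine setIntegral_mono_on (((hcont _).pow 2).integrableOn_cube a s)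
          ((continuous_const).integrableOn_cube a s) (measurableSet_cube a s) fun y hy => ?_
        exact pow_le_pow_left₀ (norm_nonneg _) (hpt y hy) 2
      rw [setIntegral_const, volume_real_cube a hs.le, smul_eq_mul] at h2
      simp only [pow_zero, div_one]
      nlinarith
    | succ n ih =>
      intro a s hs ha
      obtain ⟨m, hm⟩ := pow_unbounded_of_one_lt (2 * (d * s) / δ) (one_lt_two (α := ℝ))
      have hsd : 0 < s ^ d := by positivity
      have h := integral_cube_sq_le_of_stopping hG (l := 4 * M) (δ := δ)
        (S := (2 * B + M) ^ 2 / 2 ^ n + K) (Q := cube a₀ s₀) (c := c)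
        (by positivity) (by positivity)
        (fun a s hs => (hc a s hs).trans (by
          have : 0 < s ^ d := by positivity
          nlinarith))
        ih (fun x hx y hy hxy => by
          rw [← dist_eq_norm]; exact hδ x (hQ hx) y (hQ hy) hxy)
        (c a s) m a s hs ha ((div_le_iff₀ hδ0).1 hm.le)
        ((hc a s hs).trans (by nlinarith))
      refine h.trans ((add_le_add_right (mul_le_mul_of_nonneg_left (hc a s hs)
        (by positivity)) _).trans (le_of_eq ?_))
      rw [hK, pow_succ]
      field_simp
      ring
  refine le_of_forall_pos_le_add fun ε hε => ?_
  obtain ⟨n, hn⟩ := pow_unbounded_of_one_lt ((2 * B + M) ^ 2 * s₀ ^ d / ε) (one_lt_two (α := ℝ))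
  refine (hmain n a₀ s₀ hs₀ le_rfl).trans ?_
  have h2 : (2 * B + M) ^ 2 * s₀ ^ d / 2 ^ n ≤ ε := by
    rw [div_le_iff₀ (by positivity)]
    rw [div_lt_iff₀ hε] at hn
    linarith
  have : ((2 * B + M) ^ 2 / 2 ^ n + K) * s₀ ^ d
    = K * s₀ ^ d + (2 * B + M) ^ 2 * s₀ ^ d / 2 ^ n := by ring
  linarith

/-- Local `L²` oscillation bound for a continuous function of bounded mean oscillation. -/
theorem exists_integral_ball_sq_le_of_bmo (d : ℕ) :
    ∃ C : ℝ, 0 < C ∧ ∀ {F : Type} [NormedAddCommGroup F] [NormedSpace ℝ F]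
      {G : EuclideanSpace ℝ (Fin d) → F} {M : ℝ}, Continuous G → 0 ≤ M →
      (∀ x r, 0 < r → ⨍ y in ball x r, ‖G y - ⨍ w in ball x r, G w‖ ≤ M) →
      ∀ z r, 0 < r → ∃ b : F, ∫ x in ball z r, ‖G x - b‖ ^ 2 ≤ C * M ^ 2 * r ^ d := by
  set V := volume.real (ball (0 : EuclideanSpace ℝ (Fin d)) 1) with hV
  have hV0 : 0 < V := ENNReal.toReal_pos (measure_ball_pos _ _ one_pos).ne' measure_ball_lt_top.ne
  set N : ℝ := (d + 1) ^ d * V with hN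
  have hN0 : 0 < N := by positivity
  refine ⟨(128 + 16 * (1 + 2 ^ d) ^ 2) * N ^ 2 * 2 ^ d, by positivity, ?_⟩
  intro F _ _ G M hG hM hbmo z r hr
  set c : EuclideanSpace ℝ (Fin d) → ℝ → F := fun a s => ⨍ w in ball a ((d + 1) * s), G w with hc
  have hcont : ∀ b : F, Continuous fun x => ‖G x - b‖ := fun b => by fun_prop
  have hcube : ∀ a s, 0 < s → ∫ x in cube a s, ‖G x - c a s‖ ≤ N * M * s ^ d := by
    intro a s hs
    have hs' : 0 < (d + 1) * s := by positivity
    have h := hbmo a _ hs'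
    have hvol : volume.real (ball a ((d + 1) * s)) = N * s ^ d := by
      rw [measureReal_def, Measure.addHaar_ball_of_pos _ _ hs', ENNReal.toReal_mul,
        ENNReal.toReal_ofReal (by positivity), finrank_euclideanSpace_fin, hN, hV,
        measureReal_def, mul_pow]
      ring
    rw [setAverage_eq, hvol, smul_eq_mul, inv_mul_le_iff₀ (by positivity)] at h
    refine (setIntegral_mono_set ((hcont _).integrableOn_of_isBounded isBounded_ball)
      (ae_of_all _ fun _ => norm_nonneg _) (LE.le.eventuallyLE ?_)).trans
      (h.trans (le_of_eq (by ring)))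
    refine (cube_subset_closedBall a).trans (closedBall_subset_ball ?_)
    nlinarith
  refine ⟨c (WithLp.toLp 2 fun i => z i - r) (2 * r), ?_⟩
  refine (setIntegral_mono_set (((hcont _).pow 2).integrableOn_cube _ _)
    (ae_of_all _ fun _ => sq_nonneg _) (ball_subset_cube z r).eventuallyLE).trans ?_
  set I := ∫ x in cube (WithLp.toLp 2 fun i => z i - r) (2 * r),
    ‖G x - c (WithLp.toLp 2 fun i => z i - r) (2 * r)‖ ^ 2
  have hlim : Filter.Tendsto (fun ε : ℝ => (128 + 16 * (1 + 2 ^ d) ^ 2) * (N * (M + ε)) ^ 2 *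
      (2 * r) ^ d) (nhdsWithin 0 (Set.Ioi 0))
      (nhds ((128 + 16 * (1 + 2 ^ d) ^ 2) * (N * (M + 0)) ^ 2 * (2 * r) ^ d)) :=
    Filter.Tendsto.mono_left (Continuous.tendsto (by fun_prop) 0) nhdsWithin_le_nhds
  refine (ge_of_tendsto hlim ?_).trans (le_of_eq (by ring))
  filter_upwards [self_mem_nhdsWithin] with ε (hε : 0 < ε)
  refine integral_cube_sq_le_of_integral_cube_le hG (by positivity) (fun a s hs => ?_) _
    (by positivity)
  refine (hcube a s hs).trans ?_
  gcongr
  linarith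

theorem sq_setIntegral_le {α : Type*} [MeasurableSpace α] {μ : Measure α} {s : Set α} {g : α → ℝ}
    (hs : μ s ≠ ⊤) (hg : IntegrableOn g s μ) (hg2 : IntegrableOn (fun x => g x ^ 2) s μ) :
    (∫ x in s, g x ∂μ) ^ 2 ≤ μ.real s * ∫ x in s, g x ^ 2 ∂μ := by
  have hc : ∀ c : ℝ, IntegrableOn (fun _ => c) s μ := fun c => integrableOn_const hs
  rcases (measureReal_nonneg (μ := μ) (s := s)).eq_or_lt with h0 | h0
  · have : μ s = 0 := (measureReal_eq_zero_iff hs).1 h0.symm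
    simp [Measure.restrict_eq_zero.2 this]
  set V := μ.real s
  set m := ∫ x in s, g x ∂μ
  have h : 0 ≤ ∫ x in s, (V * g x - m) ^ 2 ∂μ := integral_nonneg fun _ => sq_nonneg _
  have h1 : ∫ x in s, (V * g x - m) ^ 2 ∂μ
      = V ^ 2 * (∫ x in s, g x ^ 2 ∂μ) - 2 * V * m * m + V * m ^ 2 := by
    have : ∀ x, (V * g x - m) ^ 2 = V ^ 2 * g x ^ 2 - 2 * V * m * g x + m ^ 2 := fun x => by ring
    simp_rw [this]
    rw [integral_add (f := fun x => V ^ 2 * g x ^ 2 - 2 * V * m * g x)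
        ((hg2.const_mul _).sub (hg.const_mul _)) (hc _),
      integral_sub (hg2.const_mul _) (hg.const_mul _), integral_const_mul, integral_const_mul,
      setIntegral_const, smul_eq_mul]
  rw [h1] at h
  have : 0 ≤ V * (V * (∫ x in s, g x ^ 2 ∂μ) - m ^ 2) := by linarith
  linarith [nonneg_of_mul_nonneg_right this h0]

theorem setIntegral_setIntegral_swap_of_continuous {X Y : Type*} [TopologicalSpace X]
    [TopologicalSpace Y] [MeasurableSpace X] [MeasurableSpace Y] [OpensMeasurableSpace X]
    [OpensMeasurableSpace Y] [T2Space X] [T2Space Y] [SecondCountableTopology X]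
    [SecondCountableTopology Y]
    {μ : Measure X} {ν : Measure Y} [IsFiniteMeasureOnCompacts μ] [IsFiniteMeasureOnCompacts ν]
    [SFinite μ] [SFinite ν] {k : X → Y → ℝ} (hk : Continuous k.uncurry)
    {K A : Set X} {L B : Set Y} (hK : IsCompact K) (hL : IsCompact L) (hA : A ⊆ K) (hB : B ⊆ L) :
    ∫ x in A, ∫ y in B, k x y ∂ν ∂μ = ∫ y in B, ∫ x in A, k x y ∂μ ∂ν := by
  refine integral_integral_swap ?_
  rw [Measure.prod_restrict]
  refine IntegrableOn.mono_set ?_ (Set.prod_mono hA hB)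
  obtain ⟨c, hc⟩ := (hK.prod hL).exists_bound_of_continuousOn hk.continuousOn
  refine Measure.integrableOn_of_bounded (M := c) ?_ hk.aestronglyMeasurable ?_
  · rw [Measure.prod_prod]
    exact ENNReal.mul_ne_top hK.measure_ne_top hL.measure_ne_top
  · exact (ae_restrict_iff' (hK.prod hL).measurableSet).2 (ae_of_all _ fun p hp => hc p hp)

theorem sq_increment_le {E : Type*} [NormedAddCommGroup E] [NormedSpace ℝ E]
    {f : E → ℝ} (hf : ContDiff ℝ 1 f) (x h : E) :
    (f (x + h) - f x) ^ 2 ≤ ‖h‖ ^ 2 * ∫ t in Set.Ioc (0 : ℝ) 1, ‖fderiv ℝ f (x + t • h)‖ ^ 2 := by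
  have hf' : Continuous (fderiv ℝ f) := hf.continuous_fderiv one_ne_zero
  have hc : Continuous fun t : ℝ => fderiv ℝ f (x + t • h) h := by fun_prop
  have h1 : f (x + h) - f x = ∫ t in Set.Ioc (0 : ℝ) 1, fderiv ℝ f (x + t • h) h := by
    rw [← intervalIntegral.integral_of_le zero_le_one,
      intervalIntegral.integral_eq_sub_of_hasDerivAt (f := fun t : ℝ => f (x + t • h))]
    · simp
    · intro t _
      have h2 : HasDerivAt (fun t : ℝ => x + t • h) h t := by
        simpa using ((hasDerivAt_id t).smul_const h).const_add x
      exact ((hf.differentiable one_ne_zero _).hasFDerivAt).comp_hasDerivAt t h2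
    · exact hc.intervalIntegrable _ _
  have hint : ∀ g : ℝ → ℝ, Continuous g → IntegrableOn g (Set.Ioc (0 : ℝ) 1) := fun g hg =>
    (hg.continuousOn.integrableOn_compact isCompact_Icc).mono_set Set.Ioc_subset_Icc_self
  rw [h1]
  refine (sq_setIntegral_le (by simp) (hint _ hc) (hint _ (hc.pow 2))).trans ?_
  simp only [Real.volume_real_Ioc, sub_zero, zero_le_one, sup_of_le_left, one_mul]
  rw [← integral_const_mul]
  refine setIntegral_mono (hint (fun t => fderiv ℝ f (x + t • h) h ^ 2) (hc.pow 2))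
    (hint (fun t => ‖h‖ ^ 2 * ‖fderiv ℝ f (x + t • h)‖ ^ 2) (by fun_prop)) fun t => ?_
  have h3 := (fderiv ℝ f (x + t • h)).le_opNorm h
  rw [← mul_pow, mul_comm, ← sq_abs, ← Real.norm_eq_abs]
  exact pow_le_pow_left₀ (norm_nonneg _) h3 2

section

variable {E : Type*} [NormedAddCommGroup E]

/-- A Lipschitz cutoff, at least `1` on `ball z (2 * R)` and supported in `ball z (3 * R)`. -/
noncomputable def tent (z : E) (R : ℝ) (x : E) : ℝ := max 0 (3 - ‖x - z‖ / R)

/-- The symmetric second difference of `f` at `x` with step `h`. -/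
def secDiff (f : E → ℝ) (x h : E) : ℝ := f (x + h) + f (x - h) - 2 * f x

theorem continuous_tent (z : E) (R : ℝ) : Continuous (tent z R) := by
  unfold tent; fun_prop

theorem tent_nonneg (z : E) (R : ℝ) (x : E) : 0 ≤ tent z R x := le_max_left _ _

theorem tent_le {R : ℝ} (hR : 0 < R) (z x : E) : tent z R x ≤ 3 :=
  max_le (by norm_num) (by have : 0 ≤ ‖x - z‖ / R := by positivity
                           linarith)

theorem one_le_tent {R : ℝ} (hR : 0 < R) {z x : E} (hx : x ∈ ball z (2 * R)) : 1 ≤ tent z R x := by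
  refine le_max_of_le_right ?_
  rw [mem_ball_iff_norm] at hx
  have := (div_le_iff₀ hR).2 hx.le
  linarith

theorem tent_eq_zero {R : ℝ} (hR : 0 < R) {z x : E} (hx : x ∉ ball z (3 * R)) :
    tent z R x = 0 := by
  refine max_eq_left ?_
  rw [mem_ball_iff_norm, not_lt] at hx
  have := (le_div_iff₀ hR).2 hx
  linarith

theorem abs_tent_add_sub_le {R : ℝ} (hR : 0 < R) (z x h : E) :
    |tent z R (x + h) - tent z R x| ≤ ‖h‖ / R := by
  unfold tent
  refine (abs_max_sub_max_le_max _ _ _ _).trans (max_le (by simp; positivity) ?_)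
  have h1 := abs_norm_sub_norm_le (x - z) (x + h - z)
  have h2 : x - z - (x + h - z) = -h := by abel
  rw [h2, norm_neg] at h1
  have h3 : 3 - ‖x + h - z‖ / R - (3 - ‖x - z‖ / R) = (‖x - z‖ - ‖x + h - z‖) / R := by ring
  rw [h3, abs_div, abs_of_pos hR]
  gcongr

theorem hasCompactSupport_tent [ProperSpace E] {R : ℝ} (hR : 0 < R) (z : E) :
    HasCompactSupport (tent z R) :=
  HasCompactSupport.intro (isCompact_closedBall z (3 * R)) fun _ hx =>
    tent_eq_zero hR fun h => hx (ball_subset_closedBall h)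

end

section

variable {E : Type*} [NormedAddCommGroup E] [InnerProductSpace ℝ E] [FiniteDimensional ℝ E]
  [MeasurableSpace E] [BorelSpace E]

theorem Continuous.integrableOn_ball {g : E → ℝ} (hg : Continuous g) (z : E) (a : ℝ) :
    IntegrableOn g (ball z a) :=
  (hg.continuousOn.integrableOn_compact (isCompact_closedBall z a)).mono_set ball_subset_closedBall

theorem setIntegral_ball_comp_add_le {g : E → ℝ} (hg : Continuous g) (hg0 : ∀ x, 0 ≤ g x)
    (z v : E) {a b : ℝ} (hab : a + ‖v‖ ≤ b) :
    ∫ x in ball z a, g (x + v) ≤ ∫ x in ball z b, g x := by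
  have h : (fun x => x + v) ⁻¹' ball (z + v) a = ball z a := by
    ext x; simp
  rw [← h, (measurePreserving_add_right volume v).setIntegral_preimage_emb
    (measurableEmbedding_addRight v) g]
  refine setIntegral_mono_set (hg.integrableOn_ball _ _) (ae_of_all _ fun x => hg0 x)
    (LE.le.eventuallyLE (ball_subset_ball' ?_))
  simpa using hab

theorem integral_ball_sq_increment_le {f : E → ℝ} (hf : ContDiff ℝ 1 f) (z h : E) {a b : ℝ}
    (hab : a + ‖h‖ ≤ b) :
    ∫ x in ball z a, (f (x + h) - f x) ^ 2 ≤
      ‖h‖ ^ 2 * ∫ x in ball z b, ‖fderiv ℝ f x‖ ^ 2 := by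
  have hf' : Continuous (fderiv ℝ f) := hf.continuous_fderiv one_ne_zero
  have hfc : Continuous f := hf.continuous
  have hk : Continuous fun p : E × ℝ => ‖fderiv ℝ f (p.1 + p.2 • h)‖ ^ 2 := by fun_prop
  have hk' : Continuous fun x => ∫ t in Set.Ioc (0 : ℝ) 1, ‖fderiv ℝ f (x + t • h)‖ ^ 2 := by
    simp_rw [← integral_Icc_eq_integral_Ioc]
    exact continuous_parametric_integral_of_continuous
      (f := fun (x : E) (t : ℝ) => ‖fderiv ℝ f (x + t • h)‖ ^ 2) hk isCompact_Icc
  calc ∫ x in ball z a, (f (x + h) - f x) ^ 2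
      ≤ ∫ x in ball z a, ‖h‖ ^ 2 * ∫ t in Set.Ioc (0 : ℝ) 1, ‖fderiv ℝ f (x + t • h)‖ ^ 2 :=
        setIntegral_mono (Continuous.integrableOn_ball (by fun_prop) _ _)
          (Continuous.integrableOn_ball (by fun_prop) _ _) fun x => sq_increment_le hf x h
    _ = ‖h‖ ^ 2 * ∫ t in Set.Ioc (0 : ℝ) 1, ∫ x in ball z a, ‖fderiv ℝ f (x + t • h)‖ ^ 2 := by
        rw [integral_const_mul, setIntegral_setIntegral_swap_of_continuous
          (k := fun (x : E) (t : ℝ) => ‖fderiv ℝ f (x + t • h)‖ ^ 2) hk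
          (isCompact_closedBall z a) isCompact_Icc ball_subset_closedBall Set.Ioc_subset_Icc_self]
    _ ≤ ‖h‖ ^ 2 * ∫ t in Set.Ioc (0 : ℝ) 1, ∫ x in ball z b, ‖fderiv ℝ f x‖ ^ 2 := by
        refine mul_le_mul_of_nonneg_left ?_ (sq_nonneg _)
        have hnn : ∀ t : ℝ, (0 : ℝ) ≤ ∫ x in ball z a, ‖fderiv ℝ f (x + t • h)‖ ^ 2 :=
          fun t => integral_nonneg fun x => sq_nonneg _
        refine integral_mono_of_nonneg (μ := volume.restrict (Set.Ioc (0 : ℝ) 1))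
          (ae_of_all _ hnn) (integrable_const _)
          ((ae_restrict_iff' measurableSet_Ioc).2 (ae_of_all _ fun t ht => ?_))
        refine setIntegral_ball_comp_add_le (g := fun x => ‖fderiv ℝ f x‖ ^ 2) (by fun_prop)
          (fun _ => by positivity) z (t • h) ?_
        rw [norm_smul, Real.norm_of_nonneg ht.1.le]
        nlinarith [norm_nonneg h, ht.2]
    _ = _ := by simp

theorem integrable_tent_mul {R : ℝ} (hR : 0 < R) (z : E) {g : E → ℝ} (hg : Continuous g) :
    Integrable fun x => tent z R x * g x :=
  ((continuous_tent z R).mul hg).integrable_of_hasCompactSupport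
    (hasCompactSupport_tent hR z).mul_right

theorem integral_tent_mul_eq {R : ℝ} (hR : 0 < R) (z : E) (g : E → ℝ) :
    ∫ x, tent z R x * g x = ∫ x in closedBall z (3 * R), tent z R x * g x := by
  refine (setIntegral_eq_integral_of_forall_compl_eq_zero fun x hx => ?_).symm
  rw [tent_eq_zero hR fun h => hx (ball_subset_closedBall h), zero_mul]

theorem continuous_integral_tent_mul {R : ℝ} (hR : 0 < R) (z : E) {X : Type*} [TopologicalSpace X]
    [FirstCountableTopology X] [LocallyCompactSpace X] {k : X → E → ℝ} (hk : Continuous k.uncurry) :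
    Continuous fun h => ∫ x, tent z R x * k h x := by
  simp_rw [integral_tent_mul_eq hR]
  refine continuous_parametric_integral_of_continuous (f := fun h x => tent z R x * k h x) ?_
    (isCompact_closedBall z (3 * R))
  exact ((continuous_tent z R).comp continuous_snd).mul hk

theorem abs_integral_tent_add_sub_le {R : ℝ} (hR : 0 < R) (z h : E) {g : E → ℝ} (hg : Continuous g)
    (hg0 : ∀ x, 0 ≤ g x) :
    |(∫ x, tent z R (x + h) * g x) - ∫ x, tent z R x * g x| ≤
      ‖h‖ / R * ∫ x in ball z (3 * R + ‖h‖), g x := by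
  have hc : HasCompactSupport fun x => tent z R (x + h) :=
    (hasCompactSupport_tent hR z).comp_homeomorph (Homeomorph.addRight h)
  have hi : Integrable fun x => tent z R (x + h) * g x :=
    (((continuous_tent z R).comp (continuous_add_const h)).mul hg).integrable_of_hasCompactSupport
      hc.mul_right
  rw [← integral_sub hi (integrable_tent_mul hR z hg), ← integral_const_mul,
    ← setIntegral_eq_integral_of_forall_compl_eq_zero (s := ball z (3 * R + ‖h‖))]
  · refine (abs_integral_le_integral_abs).trans (setIntegral_mono
      (Continuous.integrableOn_ball ?_ _ _) (Continuous.integrableOn_ball ?_ _ _) fun x => ?_)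
    · have := continuous_tent z R
      fun_prop
    · fun_prop
    · dsimp only
      rw [← sub_mul, abs_mul, abs_of_nonneg (hg0 x)]
      exact mul_le_mul_of_nonneg_right (abs_tent_add_sub_le hR z x h) (hg0 x)
  · intro x hx
    rw [mem_ball_iff_norm, not_lt] at hx
    rw [tent_eq_zero hR, tent_eq_zero hR, zero_mul, sub_zero]
    · rw [mem_ball_iff_norm, not_lt]
      linarith [norm_nonneg h]
    · rw [mem_ball_iff_norm, not_lt]
      have := norm_sub_le (x + h - z) h
      rw [show x + h - z - h = x - z by abel] at this
      linarith

theorem integral_tent_mul_sq_increment_le {f : E → ℝ} (hf : ContDiff ℝ 1 f) {R L : ℝ} (hR : 0 < R)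
    (z h : E) (hL : 3 * R + ‖h‖ ≤ L) :
    ∫ x, tent z R x * (f (x + h) - f x) ^ 2 ≤
      3 * ‖h‖ ^ 2 * ∫ x in ball z L, ‖fderiv ℝ f x‖ ^ 2 := by
  have hfc : Continuous f := hf.continuous
  have hg : Continuous fun x => (f (x + h) - f x) ^ 2 := by fun_prop
  rw [← setIntegral_eq_integral_of_forall_compl_eq_zero (s := ball z (3 * R))]
  · calc ∫ x in ball z (3 * R), tent z R x * (f (x + h) - f x) ^ 2
        ≤ ∫ x in ball z (3 * R), 3 * (f (x + h) - f x) ^ 2 :=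
          setIntegral_mono (integrable_tent_mul hR z hg).integrableOn
            ((hg.integrableOn_ball _ _).const_mul 3)
            fun x => mul_le_mul_of_nonneg_right (tent_le hR z x) (sq_nonneg _)
      _ ≤ _ := by
        rw [integral_const_mul, mul_assoc]
        exact mul_le_mul_of_nonneg_left (integral_ball_sq_increment_le hf z h hL) (by norm_num)
  · intro x hx
    rw [tent_eq_zero hR hx, zero_mul]

/-- The parallelogram law makes weighted second differences telescope across dyadic scales. -/
theorem integral_tent_mul_sq_secDiff_le {f : E → ℝ} (hf : ContDiff ℝ 1 f) {R L : ℝ} (hR : 0 < R)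
    (z h : E) (hL : 3 * R + 3 * ‖h‖ ≤ L) :
    ∫ x, tent z R x * secDiff f x h ^ 2 ≤
      4 * (∫ x, tent z R x * (f (x + h) - f x) ^ 2) -
        (∫ x, tent z R x * (f (x + (2 : ℝ) • h) - f x) ^ 2) +
        6 * (‖h‖ ^ 3 / R) * ∫ x in ball z L, ‖fderiv ℝ f x‖ ^ 2 := by
  have hfc : Continuous f := hf.continuous
  set A := ∫ x in ball z L, ‖fderiv ℝ f x‖ ^ 2
  set D : E → ℝ := fun x => (f (x + h) - f x) ^ 2 with hD
  set D2 : E → ℝ := fun x => (f (x + (2 : ℝ) • h) - f x) ^ 2 with hD2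
  have hDc : Continuous D := by fun_prop
  have hD2c : Continuous D2 := by fun_prop
  have hn := norm_nonneg h
  have h1 : ∀ x, tent z R x * secDiff f x h ^ 2 =
      2 * (tent z R x * D x) + 2 * (tent z R x * D (x - h)) - tent z R x * D2 (x - h) := by
    intro x
    have e : x - h + (2 : ℝ) • h = x + h := by rw [two_smul]; abel
    simp only [hD, hD2, secDiff, sub_add_cancel, e]
    ring
  have hshift : ∀ g : E → ℝ, ∫ x, tent z R x * g (x - h) = ∫ x, tent z R (x + h) * g x := by
    intro g
    rw [← integral_add_right_eq_self (fun x => tent z R x * g (x - h)) h]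
    simp
  have hs1 := abs_le.1 (abs_integral_tent_add_sub_le hR z h hDc fun x => sq_nonneg _)
  have hs2 := abs_le.1 (abs_integral_tent_add_sub_le hR z h hD2c fun x => sq_nonneg _)
  have hb1 := integral_ball_sq_increment_le hf z h (a := 3 * R + ‖h‖) (b := L) (by linarith)
  have hb2 := integral_ball_sq_increment_le hf z ((2 : ℝ) • h) (a := 3 * R + ‖h‖) (b := L)
    (by rw [norm_smul, Real.norm_ofNat]; linarith)
  rw [norm_smul, Real.norm_ofNat] at hb2
  have hb1' := mul_le_mul_of_nonneg_left hb1 (div_nonneg hn hR.le)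
  have hb2' := mul_le_mul_of_nonneg_left hb2 (div_nonneg hn hR.le)
  have i1 := (integrable_tent_mul hR z hDc).const_mul 2
  have i2 : Integrable fun x => 2 * (tent z R x * D (x - h)) :=
    (integrable_tent_mul hR z (hDc.comp (continuous_sub_right h))).const_mul 2
  have i3 : Integrable fun x => tent z R x * D2 (x - h) :=
    integrable_tent_mul hR z (hD2c.comp (continuous_sub_right h))
  simp_rw [h1]
  rw [integral_sub (f := fun x => 2 * (tent z R x * D x) + 2 * (tent z R x * D (x - h)))
      (i1.add i2) i3, integral_add i1 i2, integral_const_mul, integral_const_mul, hshift, hshift]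
  have e1 : ‖h‖ / R * (‖h‖ ^ 2 * A) = ‖h‖ ^ 3 / R * A := by ring
  have e2 : ‖h‖ / R * ((2 * ‖h‖) ^ 2 * A) = 4 * (‖h‖ ^ 3 / R * A) := by ring
  rw [e1] at hb1'
  rw [e2] at hb2'
  linarith [hs1.2, hs2.1]

end

theorem lintegral_Ioo_le_of_telescoping {N φ : ℝ → ℝ} {R B : ℝ} (hR : 0 < R) (hB : 0 ≤ B)
    (hφc : ContinuousOn φ (Set.Ioi 0)) (hφ0 : ∀ r, 0 < r → 0 ≤ φ r)
    (hφB : ∀ r, 0 < r → r < R → φ r ≤ B) (hN0 : ∀ r, 0 < r → r < R → 0 ≤ N r)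
    (hN : ∀ r, 0 < r → r < R → N r ≤ φ r - φ (2 * r) + B * (r / R)) :
    ∫⁻ r in Set.Ioo 0 R, ENNReal.ofReal (N r / r) ≤ ENNReal.ofReal (2 * B) := by
  have hU : Set.Ioo 0 R = ⋃ n : ℕ, Set.Ioo (R / (n + 3)) R := by
    ext r
    simp only [Set.mem_Ioo, Set.mem_iUnion]
    constructor
    · rintro ⟨h0, hr⟩
      obtain ⟨n, hn⟩ := exists_nat_gt (R / r)
      refine ⟨n, ?_, hr⟩
      rw [div_lt_iff₀ h0] at hn
      rw [div_lt_iff₀ (by positivity)]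
      nlinarith
    · rintro ⟨n, h0, hr⟩
      exact ⟨lt_trans (by positivity) h0, hr⟩
  rw [hU, setLIntegral_iUnion_of_directed]
  swap
  · refine Monotone.directed_le fun m n hmn => Set.Ioo_subset_Ioo_left ?_
    gcongr
  refine iSup_le fun n => ?_
  set ε := R / ((n : ℝ) + 3) with hε
  have hε0 : 0 < ε := by positivity
  have hεR : 2 * ε < R := by
    rw [hε, ← mul_div_assoc, div_lt_iff₀ (by positivity)]
    nlinarith [(n.cast_nonneg : (0 : ℝ) ≤ n)]
  set q : ℝ → ℝ := fun r => φ r / r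
  have hqc : ContinuousOn q (Set.Ioi 0) := hφc.div continuousOn_id fun r hr => ne_of_gt hr
  have hqi : ∀ a b : ℝ, 0 < a → 0 < b → IntervalIntegrable q volume a b := fun a b ha hb =>
    (hqc.mono fun x hx => lt_of_lt_of_le (lt_min ha hb) hx.1).intervalIntegrable
  have hq2c : ContinuousOn (fun r => 2 * q (2 * r)) (Set.Icc ε R) :=
    continuousOn_const.mul (hqc.comp (by fun_prop) fun x hx => by
      have := hx.1
      simp only [Set.mem_Ioi]; linarith)
  have hq2i : IntervalIntegrable (fun r => 2 * q (2 * r)) volume ε R :=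
    hq2c.intervalIntegrable_of_Icc (by linarith)
  have hPi : IntervalIntegrable (fun r => q r - 2 * q (2 * r) + B / R) volume ε R :=
    ((hqi ε R hε0 hR).sub hq2i).add intervalIntegrable_const
  have hP : ∀ r ∈ Set.Ioo ε R, N r / r ≤ q r - 2 * q (2 * r) + B / R := by
    intro r hr
    have hr0 : 0 < r := hε0.trans hr.1
    have e : q r - 2 * q (2 * r) + B / R = (φ r - φ (2 * r) + B * (r / R)) / r := by
      simp only [q]; field_simp
    rw [e]
    gcongr
    exact hN r hr0 hr.2
  calc ∫⁻ r in Set.Ioo ε R, ENNReal.ofReal (N r / r)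
      ≤ ∫⁻ r in Set.Ioo ε R, ENNReal.ofReal (q r - 2 * q (2 * r) + B / R) :=
        setLIntegral_mono' measurableSet_Ioo fun r hr => ENNReal.ofReal_le_ofReal (hP r hr)
    _ = ENNReal.ofReal (∫ r in Set.Ioo ε R, (q r - 2 * q (2 * r) + B / R)) := by
        rw [ofReal_integral_eq_lintegral_ofReal]
        · exact ((intervalIntegrable_iff_integrableOn_Ioo_of_le (by linarith)).1 hPi)
        · refine (ae_restrict_iff' measurableSet_Ioo).2 (ae_of_all _ fun r hr => ?_)
          have hr0 : 0 < r := hε0.trans hr.1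
          exact (div_nonneg (hN0 r hr0 hr.2) hr0.le).trans (hP r hr)
    _ ≤ ENNReal.ofReal (2 * B) := by
        refine ENNReal.ofReal_le_ofReal ?_
        rw [← integral_Ioc_eq_integral_Ioo, ← intervalIntegral.integral_of_le (by linarith),
          intervalIntegral.integral_add ((hqi ε R hε0 hR).sub hq2i) intervalIntegrable_const,
          intervalIntegral.integral_sub (hqi ε R hε0 hR) hq2i, intervalIntegral.integral_const_mul,
          intervalIntegral.mul_integral_comp_mul_left, intervalIntegral.integral_const, smul_eq_mul]
        have h2R : (0 : ℝ) < 2 * R := by positivity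
        have h2ε : (0 : ℝ) < 2 * ε := by positivity
        have s1 := intervalIntegral.integral_add_adjacent_intervals (hqi ε _ hε0 h2ε)
          (hqi _ R h2ε hR)
        have s2 := intervalIntegral.integral_add_adjacent_intervals (hqi _ R h2ε hR)
          (hqi R _ hR h2R)
        have s3 : 0 ≤ ∫ r in R..2 * R, q r :=
          intervalIntegral.integral_nonneg (by linarith) fun r hr =>
            div_nonneg (hφ0 r (by linarith [hr.1])) (by linarith [hr.1])
        have s4 : ∫ r in ε..2 * ε, q r ≤ ∫ r in ε..2 * ε, B / ε := by
          refine intervalIntegral.integral_mono_on (by linarith) (hqi _ _ hε0 h2ε)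
            intervalIntegrable_const fun r hr => ?_
          have hr0 : 0 < r := by linarith [hr.1]
          exact div_le_div₀ hB (hφB r hr0 (by linarith [hr.2])) hε0 hr.1
        rw [intervalIntegral.integral_const, smul_eq_mul] at s4
        have s5 : (2 * ε - ε) * (B / ε) = B := by field_simp; ring
        have s6 : (R - ε) * (B / R) ≤ B := by
          rw [mul_div_assoc', div_le_iff₀ hR]; nlinarith
        linarith

theorem lintegral_integral_sq_secDiff_le {E : Type*} [NormedAddCommGroup E] [InnerProductSpace ℝ E]
    [FiniteDimensional ℝ E] [MeasurableSpace E] [BorelSpace E] {f : E → ℝ} (hf : ContDiff ℝ 1 f)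
    {R ρ : ℝ} (hR : 0 < R) (hρ : 0 < ρ) (z : E) :
    ∫⁻ r in Set.Ioo 0 R, ENNReal.ofReal
        ((r ^ 2)⁻¹ * (∫ w in closedBall (0 : E) ρ, ∫ x, tent z R x * secDiff f x (r • w) ^ 2) / r) ≤
      ENNReal.ofReal (2 * ((12 * ρ ^ 2 + 6 * ρ ^ 3) * volume.real (closedBall (0 : E) ρ) *
        ∫ x in ball z ((3 + 3 * ρ) * R), ‖fderiv ℝ f x‖ ^ 2)) := by
  set A := ∫ x in ball z ((3 + 3 * ρ) * R), ‖fderiv ℝ f x‖ ^ 2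
  set V := volume.real (closedBall (0 : E) ρ)
  set Φ : E → ℝ := fun h => ∫ x, tent z R x * (f (x + h) - f x) ^ 2
  set Ψ : E → ℝ := fun h => ∫ x, tent z R x * secDiff f x h ^ 2
  have hA : 0 ≤ A := integral_nonneg fun _ => sq_nonneg _
  have hV : 0 ≤ V := measureReal_nonneg
  have hfc : Continuous f := hf.continuous
  have hΦc : Continuous Φ := continuous_integral_tent_mul hR z
    (k := fun h x => (f (x + h) - f x) ^ 2) (by unfold Function.uncurry; fun_prop)
  have hΨc : Continuous Ψ := continuous_integral_tent_mul hR z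
    (k := fun h x => secDiff f x h ^ 2) (by unfold Function.uncurry secDiff; fun_prop)
  have hΦ0 : ∀ h, 0 ≤ Φ h := fun h =>
    integral_nonneg fun x => mul_nonneg (tent_nonneg z R x) (sq_nonneg _)
  have hΨ0 : ∀ h, 0 ≤ Ψ h := fun h =>
    integral_nonneg fun x => mul_nonneg (tent_nonneg z R x) (sq_nonneg _)
  have hK := isCompact_closedBall (0 : E) ρ
  have hi : ∀ g : E → ℝ, Continuous g → IntegrableOn g (closedBall (0 : E) ρ) := fun g hg =>
    hg.continuousOn.integrableOn_compact hK
  have hsm : ∀ r, 0 < r → ∀ w ∈ closedBall (0 : E) ρ, ‖r • w‖ ≤ ρ * r := fun r hr w hw => by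
    rw [norm_smul, Real.norm_of_nonneg hr.le, mul_comm]
    exact mul_le_mul_of_nonneg_right (mem_closedBall_zero_iff.1 hw) hr.le
  refine lintegral_Ioo_le_of_telescoping
    (N := fun r => (r ^ 2)⁻¹ * ∫ w in closedBall (0 : E) ρ, Ψ (r • w))
    (φ := fun r => (r ^ 2)⁻¹ * ∫ w in closedBall (0 : E) ρ, 4 * Φ (r • w)) hR (by positivity)
    ?_ (fun r hr => ?_) (fun r hr hrR => ?_) (fun r hr hrR => ?_) fun r hr hrR => ?_
  · refine ContinuousOn.mul (ContinuousOn.inv₀ (by fun_prop) fun r hr => ?_)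
      (Continuous.continuousOn ?_)
    · exact pow_ne_zero 2 (ne_of_gt hr)
    · exact continuous_parametric_integral_of_continuous (f := fun (r : ℝ) (w : E) => 4 * Φ (r • w))
        (by unfold Function.uncurry; fun_prop) hK
  · exact mul_nonneg (by positivity) (integral_nonneg fun w => mul_nonneg (by norm_num) (hΦ0 _))
  · have h1 : ∫ w in closedBall (0 : E) ρ, 4 * Φ (r • w) ≤
        ∫ _ in closedBall (0 : E) ρ, 12 * (ρ * r) ^ 2 * A := by
      refine setIntegral_mono_on (hi _ (by fun_prop)) (hi _ (by fun_prop)) hK.measurableSet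
        fun w hw => ?_
      have h2 := hsm r hr w hw
      have h3 := integral_tent_mul_sq_increment_le hf hR z (r • w) (L := (3 + 3 * ρ) * R)
        (by nlinarith)
      have h4 : ‖r • w‖ ^ 2 ≤ (ρ * r) ^ 2 := pow_le_pow_left₀ (norm_nonneg _) h2 2
      have h5 := mul_le_mul_of_nonneg_right h4 hA
      change 4 * (∫ x, tent z R x * (f (x + r • w) - f x) ^ 2) ≤ _
      linarith
    rw [setIntegral_const, smul_eq_mul] at h1
    calc _ ≤ (r ^ 2)⁻¹ * (V * (12 * (ρ * r) ^ 2 * A)) := by gcongr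
      _ = 12 * ρ ^ 2 * V * A := by field_simp
      _ ≤ _ := by gcongr; nlinarith [pow_pos hρ 3]
  · exact mul_nonneg (by positivity) (integral_nonneg fun w => hΨ0 _)
  · have h1 : ∫ w in closedBall (0 : E) ρ, Ψ (r • w) ≤ ∫ w in closedBall (0 : E) ρ,
        (4 * Φ (r • w) - Φ ((2 * r) • w) + 6 * ((ρ * r) ^ 3 / R) * A) := by
      refine setIntegral_mono_on (hi _ (by fun_prop)) (hi _ (by fun_prop)) hK.measurableSet
        fun w hw => ?_
      have h2 := hsm r hr w hw
      have h3 := integral_tent_mul_sq_secDiff_le hf hR z (r • w) (L := (3 + 3 * ρ) * R)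
        (by nlinarith)
      have h4 : ‖r • w‖ ^ 3 / R ≤ (ρ * r) ^ 3 / R := by gcongr
      have h5 := mul_le_mul_of_nonneg_right h4 hA
      rw [smul_smul] at h3
      change (∫ x, tent z R x * secDiff f x (r • w) ^ 2) ≤
        4 * (∫ x, tent z R x * (f (x + r • w) - f x) ^ 2) -
        (∫ x, tent z R x * (f (x + (2 * r) • w) - f x) ^ 2) + _
      linarith
    rw [integral_add (f := fun w => 4 * Φ (r • w) - Φ ((2 * r) • w)) (hi _ (by fun_prop))
        (hi _ (by fun_prop)), integral_sub (f := fun w => 4 * Φ (r • w)) (hi _ (by fun_prop))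
        (hi _ (by fun_prop)), setIntegral_const, smul_eq_mul] at h1
    calc _ ≤ (r ^ 2)⁻¹ * _ := mul_le_mul_of_nonneg_left h1 (by positivity)
      _ = (r ^ 2)⁻¹ * (∫ w in closedBall (0 : E) ρ, 4 * Φ (r • w)) -
          ((2 * r) ^ 2)⁻¹ * (∫ w in closedBall (0 : E) ρ, 4 * Φ ((2 * r) • w)) +
          6 * ρ ^ 3 * V * A * (r / R) := by
        rw [integral_const_mul 4 fun w => Φ ((2 * r) • w)]
        field_simp
        ring
      _ ≤ _ := by
        gcongr
        nlinarith [pow_pos hρ 2]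

theorem exists_lintegral_integral_sq_secDiff_le_of_bmo (d : ℕ) {ρ : ℝ} (hρ : 0 < ρ) :
    ∃ C : ℝ, 0 < C ∧ ∀ (M : ℝ) (f : EuclideanSpace ℝ (Fin d) → ℝ), 0 ≤ M → ContDiff ℝ 1 f →
      (∀ x r, 0 < r → ⨍ y in ball x r, ‖gradient f y - ⨍ w in ball x r, gradient f w‖ ≤ M) →
      ∀ z R, 0 < R → ∫⁻ r in Set.Ioo 0 R, ENNReal.ofReal ((r ^ 2)⁻¹ *
        (∫ w in closedBall 0 ρ, ∫ x, tent z R x * secDiff f x (r • w) ^ 2) / r) ≤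
        ENNReal.ofReal (C * M ^ 2 * R ^ d) := by
  obtain ⟨C, hC, h⟩ := exists_integral_ball_sq_le_of_bmo d
  set V := volume.real (closedBall (0 : EuclideanSpace ℝ (Fin d)) ρ)
  have hV : 0 < V :=
    ENNReal.toReal_pos (measure_closedBall_pos _ _ hρ).ne' measure_closedBall_lt_top.ne
  refine ⟨2 * ((12 * ρ ^ 2 + 6 * ρ ^ 3) * V * (C * (3 + 3 * ρ) ^ d)), by positivity,
    fun M f hM hf hbmo z R hR => ?_⟩
  have hgc : Continuous (gradient f) :=
    (InnerProductSpace.toDual ℝ _).symm.continuous.comp (hf.continuous_fderiv one_ne_zero)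
  obtain ⟨b, hb⟩ := h hgc hM hbmo z ((3 + 3 * ρ) * R) (by positivity)
  have hg : ContDiff ℝ 1 fun x => f x - innerSL ℝ b x := hf.sub (innerSL ℝ b).contDiff
  have hfd : ∀ x, ‖fderiv ℝ (fun x => f x - innerSL ℝ b x) x‖ = ‖gradient f x - b‖ := by
    intro x
    rw [fderiv_fun_sub (hf.differentiable one_ne_zero x) (innerSL ℝ b).differentiableAt,
      ContinuousLinearMap.fderiv, ← (InnerProductSpace.toDual ℝ (EuclideanSpace ℝ (Fin d))).norm_map
        (gradient f x - b), map_sub, gradient,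
      LinearIsometryEquiv.apply_symm_apply]
    rfl
  have hsec : ∀ x v, secDiff (fun x => f x - innerSL ℝ b x) x v = secDiff f x v := by
    intro x v
    simp only [secDiff, map_add, map_sub]
    ring
  have key := lintegral_integral_sq_secDiff_le hg hR hρ z
  simp_rw [hsec, hfd] at key
  refine key.trans (ENNReal.ofReal_le_ofReal ?_)
  calc _ ≤ 2 * ((12 * ρ ^ 2 + 6 * ρ ^ 3) * V * (C * M ^ 2 * ((3 + 3 * ρ) * R) ^ d)) := by gcongr
    _ = _ := by rw [mul_pow]; ring

section

variable {E : Type*} [NormedAddCommGroup E] [InnerProductSpace ℝ E] [FiniteDimensional ℝ E]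
  [MeasurableSpace E] [BorelSpace E]

open scoped Convolution in
theorem hasFDerivAt_integral_mul_sub {F q : E → ℝ} (hF : Continuous F) (hq : ContDiff ℝ 1 q)
    (hqc : HasCompactSupport q) (x : E) :
    ∃ D : E →L[ℝ] ℝ, HasFDerivAt (fun y => ∫ t, F t * q (y - t)) D x ∧
      ∀ u, D u = ∫ t, F t * fderiv ℝ q (x - t) u := by
  refine ⟨_, hqc.hasFDerivAt_convolution_right (ContinuousLinearMap.mul ℝ ℝ)
    (hF.locallyIntegrable (μ := volume)) hq x, fun u => ?_⟩
  rw [convolution_precompR_apply _ hF.locallyIntegrable (hqc.fderiv ℝ)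
    (hq.continuous_fderiv one_ne_zero)]
  rfl

theorem integral_fderiv_apply_eq_zero {q : E → ℝ} (hq : ContDiff ℝ 1 q)
    (hqc : HasCompactSupport q) (u : E) : ∫ x, fderiv ℝ q x u = 0 := by
  obtain ⟨D, hD, h⟩ := hasFDerivAt_integral_mul_sub (continuous_const (y := (1 : ℝ))) hq hqc 0
  have h2 : (fun y => ∫ t, (1 : ℝ) * q (y - t)) = fun _ => ∫ t, q t := by
    ext y
    simp only [one_mul]
    exact integral_sub_left_eq_self q volume y
  rw [h2] at hD
  have h3 := h u
  rw [hD.unique (hasFDerivAt_const _ _)] at h3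
  simp only [one_mul] at h3
  rw [integral_sub_left_eq_self (fun x => fderiv ℝ q x u) volume 0] at h3
  simpa using h3.symm

theorem integral_mul_sub_eq_of_even {F q : E → ℝ} (hF : Continuous F) (hq : Continuous q)
    (heven : ∀ w, q (-w) = q w) {ρ : ℝ} (hqρ : ∀ w ∉ closedBall (0 : E) ρ, q w = 0) (y : E) :
    (∫ t, F t * q (y - t)) - (∫ t, q t) * F y =
      1 / 2 * ∫ w in closedBall (0 : E) ρ, secDiff F y w * q w := by
  have hK := isCompact_closedBall (0 : E) ρ
  have hi : ∀ g : E → ℝ, Continuous g → IntegrableOn g (closedBall (0 : E) ρ) := fun g hg =>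
    hg.continuousOn.integrableOn_compact hK
  have h0 : ∀ g : E → ℝ, ∫ w in closedBall (0 : E) ρ, g w * q w = ∫ w, g w * q w := fun g =>
    setIntegral_eq_integral_of_forall_compl_eq_zero fun w hw => by rw [hqρ w hw, mul_zero]
  have h1 : ∫ t, F t * q (y - t) = ∫ w in closedBall (0 : E) ρ, F (y - w) * q w := by
    rw [h0, ← integral_sub_left_eq_self (fun t => F t * q (y - t)) volume y]
    simp
  have h2 : ∫ t, F t * q (y - t) = ∫ w in closedBall (0 : E) ρ, F (y + w) * q w := by
    rw [h1, h0, h0, ← integral_neg_eq_self]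
    simp [heven]
  have h3 : ∫ t, q t = ∫ w in closedBall (0 : E) ρ, q w := by
    simpa using (h0 fun _ => 1).symm
  have h4 : ∫ w in closedBall (0 : E) ρ, secDiff F y w * q w =
      (∫ w in closedBall (0 : E) ρ, F (y + w) * q w) +
      (∫ w in closedBall (0 : E) ρ, F (y - w) * q w) -
      2 * F y * ∫ w in closedBall (0 : E) ρ, q w := by
    rw [← integral_const_mul, ← integral_add (hi _ (by fun_prop)) (hi _ (by fun_prop)),
      ← integral_sub (hi _ (by fun_prop)) (hi _ (by fun_prop))]
    congr 1
    ext w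
    simp only [secDiff]
    ring
  rw [h4, ← h1, ← h2, ← h3]
  ring

theorem sq_integral_mul_sub_le_of_even {F q : E → ℝ} (hF : Continuous F) (hq : Continuous q)
    (heven : ∀ w, q (-w) = q w) {ρ K : ℝ} (hqρ : ∀ w ∉ closedBall (0 : E) ρ, q w = 0)
    (hqK : ∀ w, |q w| ≤ K) (y : E) :
    ((∫ t, F t * q (y - t)) - (∫ t, q t) * F y) ^ 2 ≤ volume.real (closedBall (0 : E) ρ) * K ^ 2 *
      ∫ w in closedBall (0 : E) ρ, secDiff F y w ^ 2 := by
  have hK := isCompact_closedBall (0 : E) ρ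
  have hi : ∀ g : E → ℝ, Continuous g → IntegrableOn g (closedBall (0 : E) ρ) := fun g hg =>
    hg.continuousOn.integrableOn_compact hK
  have hs : Continuous fun w => secDiff F y w := by unfold secDiff; fun_prop
  rw [integral_mul_sub_eq_of_even hF hq heven hqρ, mul_pow]
  have h1 := sq_setIntegral_le (g := fun w => secDiff F y w * q w) hK.measure_ne_top
    (hi _ (hs.mul hq)) (hi _ ((hs.mul hq).pow 2))
  have h2 : ∫ w in closedBall (0 : E) ρ, (secDiff F y w * q w) ^ 2 ≤
      K ^ 2 * ∫ w in closedBall (0 : E) ρ, secDiff F y w ^ 2 := by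
    rw [← integral_const_mul]
    refine setIntegral_mono (hi _ ((hs.mul hq).pow 2)) (hi _ (by fun_prop)) fun w => ?_
    dsimp only
    rw [mul_pow, mul_comm, ← sq_abs (q w)]
    gcongr
    exact hqK w
  have h3 := mul_le_mul_of_nonneg_left h2
    (measureReal_nonneg (μ := volume) (s := closedBall (0 : E) ρ))
  have h4 := sq_nonneg (∫ w in closedBall (0 : E) ρ, secDiff F y w * q w)
  linarith

end

theorem exists_sq_sub_taylor_le {E : Type*} [NormedAddCommGroup E] [InnerProductSpace ℝ E]
    [FiniteDimensional ℝ E] [MeasurableSpace E] [BorelSpace E] {ψ : E → ℝ} (hψ : ContDiff ℝ 2 ψ)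
    (hψc : HasCompactSupport ψ) (heven : ∀ w, ψ (-w) = ψ w) (hint : ∫ w, ψ w = 1) :
    ∃ C ρ : ℝ, 0 < C ∧ 0 < ρ ∧ ∀ F : E → ℝ, Continuous F → ∀ u, ‖u‖ ≤ 1 →
      (F u - (∫ t, F t * ψ (0 - t)) - fderiv ℝ (fun y => ∫ t, F t * ψ (y - t)) 0 u) ^ 2 ≤
        C * ((∫ w in closedBall (0 : E) ρ, secDiff F u w ^ 2) +
          ∫ s in Set.Ioc (0 : ℝ) 1, ∫ w in closedBall (0 : E) ρ, secDiff F (s • u) w ^ 2) := by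
  have hψ1 : ContDiff ℝ 1 ψ := hψ.of_le one_le_two
  have hψ' : ContDiff ℝ 1 (fderiv ℝ ψ) := hψ.fderiv_right (by norm_num)
  have hψ'' : Continuous (fderiv ℝ (fderiv ℝ ψ)) := hψ'.continuous_fderiv one_ne_zero
  have hψ₀ : Continuous ψ := hψ.continuous
  have hψn : Continuous fun p : E × E => fderiv ℝ (fderiv ℝ ψ) p.1 p.2 p.2 :=
    ((hψ''.comp continuous_fst).clm_apply continuous_snd).clm_apply continuous_snd
  obtain ⟨ρ, hρ, hsupp⟩ := hψc.isCompact.isBounded.subset_closedBall_lt 0 (0 : E)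
  obtain ⟨K₀, hK₀⟩ :=
    (isCompact_closedBall (0 : E) ρ).exists_bound_of_continuousOn hψ₀.continuousOn
  obtain ⟨K₂, hK₂⟩ :=
    ((isCompact_closedBall (0 : E) ρ).prod
      (isCompact_closedBall (0 : E) 1)).exists_bound_of_continuousOn hψn.continuousOn
  set K := max K₀ K₂ + 1
  have hKpos : 0 < K := by
    have := (norm_nonneg _).trans (hK₀ 0 (mem_closedBall_self hρ.le))
    have := le_max_left K₀ K₂
    linarith
  set V := volume.real (closedBall (0 : E) ρ)
  have hV : 0 < V :=
    ENNReal.toReal_pos (measure_closedBall_pos _ _ hρ).ne' measure_closedBall_lt_top.ne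
  refine ⟨2 * (V * K ^ 2), ρ, by positivity, hρ, fun F hF u hu => ?_⟩
  set q₁ : E → ℝ := fun w => fderiv ℝ ψ w u with hq₁
  set q₂ : E → ℝ := fun w => fderiv ℝ q₁ w u
  have hq₁s : ContDiff ℝ 1 q₁ := hψ'.clm_apply contDiff_const
  have hq₁c : HasCompactSupport q₁ := hψc.fderiv_apply ℝ u
  have hq₂c : Continuous q₂ := (hq₁s.continuous_fderiv one_ne_zero).clm_apply continuous_const
  have hq₂e : ∀ w, q₂ w = fderiv ℝ (fderiv ℝ ψ) w u u := by
    intro w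
    simp only [q₂, hq₁]
    rw [fderiv_clm_apply (hψ'.differentiable one_ne_zero w) (differentiableAt_const u)]
    simp
  have hodd : ∀ w, fderiv ℝ ψ (-w) = -fderiv ℝ ψ w := by
    intro w
    have h := fderiv_comp_smul (f := ψ) (x := w) (-1 : ℝ)
    simp only [neg_smul, one_smul, heven] at h
    rw [h, neg_neg]
  have heven₂ : ∀ w, q₂ (-w) = q₂ w := by
    intro w
    have h := fderiv_comp_smul (f := q₁) (x := w) (-1 : ℝ)
    simp only [neg_smul, one_smul] at h
    have h' : (fun w => q₁ (-w)) = fun w => -q₁ w := by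
      ext w
      simp [hq₁, hodd]
    rw [h', fderiv_fun_neg] at h
    simp only [q₂]
    rw [← neg_neg (fderiv ℝ q₁ (-w)), ← h, neg_neg]
  have hz₀ : ∀ w ∉ closedBall (0 : E) ρ, ψ w = 0 := fun w hw =>
    image_eq_zero_of_notMem_tsupport fun h => hw (hsupp h)
  have hz₂ : ∀ w ∉ closedBall (0 : E) ρ, q₂ w = 0 := fun w hw =>
    image_eq_zero_of_notMem_tsupport fun h => hw (hsupp (tsupport_fderiv_apply_subset ℝ u
      (tsupport_fderiv_apply_subset ℝ u h)))
  have hbd₂ : ∀ w, |q₂ w| ≤ K := by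
    intro w
    by_cases hw : w ∈ closedBall (0 : E) ρ
    swap
    · rw [hz₂ w hw, abs_zero]
      exact hKpos.le
    have := hK₂ (w, u) ⟨hw, mem_closedBall_zero_iff.2 hu⟩
    have := le_max_right K₀ K₂
    rw [Real.norm_eq_abs] at *
    rw [hq₂e]
    linarith
  have hbd₀ : ∀ w, |ψ w| ≤ K := by
    intro w
    by_cases hw : w ∈ closedBall (0 : E) ρ
    swap
    · rw [hz₀ w hw, abs_zero]
      exact hKpos.le
    have := hK₀ w hw
    have := le_max_left K₀ K₂
    rw [Real.norm_eq_abs] at *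
    linarith
  have hint₂ : ∫ w, q₂ w = 0 := integral_fderiv_apply_eq_zero hq₁s hq₁c u
  set Θ : E → ℝ := fun y => ∫ w in closedBall (0 : E) ρ, secDiff F y w ^ 2
  have hΘc : Continuous Θ := continuous_parametric_integral_of_continuous
    (f := fun y w => secDiff F y w ^ 2) (by unfold Function.uncurry secDiff; fun_prop)
    (isCompact_closedBall _ _)
  set S₀ : E → ℝ := fun y => ∫ t, F t * ψ (y - t) with hS₀
  set S₁ : E → ℝ := fun y => ∫ t, F t * q₁ (y - t) with hS₁
  set S₂ : E → ℝ := fun y => ∫ t, F t * q₂ (y - t) with hS₂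
  have hb₀ : (S₀ u - F u) ^ 2 ≤ V * K ^ 2 * Θ u := by
    have := sq_integral_mul_sub_le_of_even hF hψ₀ heven hz₀ hbd₀ u
    rwa [hint, one_mul] at this
  have hb₂ : ∀ y, S₂ y ^ 2 ≤ V * K ^ 2 * Θ y := by
    intro y
    have := sq_integral_mul_sub_le_of_even hF hq₂c heven₂ hz₂ hbd₂ y
    rwa [hint₂, zero_mul, sub_zero] at this
  have hS₂c : Continuous S₂ := by
    have h2 : S₂ = fun y => 1 / 2 * ∫ w in closedBall (0 : E) ρ, secDiff F y w * q₂ w := by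
      ext y
      rw [← integral_mul_sub_eq_of_even hF hq₂c heven₂ hz₂, hint₂]
      ring
    rw [h2]
    exact continuous_const.mul (continuous_parametric_integral_of_continuous
      (f := fun y w => secDiff F y w * q₂ w) (by unfold Function.uncurry secDiff; fun_prop)
      (isCompact_closedBall _ _))
  have hline : ∀ t : ℝ, HasDerivAt (fun t : ℝ => t • u) u t := fun t => by
    simpa using (hasDerivAt_id t).smul_const u
  have hd₀ : ∀ t : ℝ, HasDerivAt (fun t : ℝ => S₀ (t • u)) (S₁ (t • u)) t := by
    intro t
    obtain ⟨D, hD, h⟩ := hasFDerivAt_integral_mul_sub hF hψ1 hψc (t • u)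
    have := hD.comp_hasDerivAt t (hline t)
    rwa [h] at this
  have hd₁ : ∀ t : ℝ, HasDerivAt (fun t : ℝ => S₁ (t • u)) (S₂ (t • u)) t := by
    intro t
    obtain ⟨D, hD, h⟩ := hasFDerivAt_integral_mul_sub hF hq₁s hq₁c (t • u)
    have := hD.comp_hasDerivAt t (hline t)
    rwa [h] at this
  have hf₀ : fderiv ℝ S₀ 0 u = S₁ 0 := by
    obtain ⟨D, hD, h⟩ := hasFDerivAt_integral_mul_sub hF hψ1 hψc 0
    rw [hD.fderiv, h]
  have htaylor : S₀ u - S₀ 0 - S₁ 0 = ∫ t in Set.Ioc (0 : ℝ) 1, (1 - t) * S₂ (t • u) := by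
    rw [← intervalIntegral.integral_of_le zero_le_one,
      intervalIntegral.integral_eq_sub_of_hasDerivAt
        (f := fun t : ℝ => (1 - t) * S₁ (t • u) + S₀ (t • u))]
    · simp
      ring
    · intro t _
      refine ((((hasDerivAt_id t).const_sub 1).mul (hd₁ t)).add (hd₀ t)).congr_deriv ?_
      simp only [id]
      ring
    · exact Continuous.intervalIntegrable (by fun_prop) _ _
  have hi : ∀ g : ℝ → ℝ, Continuous g → IntegrableOn g (Set.Ioc (0 : ℝ) 1) := fun g hg =>
    (hg.continuousOn.integrableOn_compact isCompact_Icc).mono_set Set.Ioc_subset_Icc_self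
  have hrem : (S₀ u - S₀ 0 - S₁ 0) ^ 2 ≤ V * K ^ 2 * ∫ s in Set.Ioc (0 : ℝ) 1, Θ (s • u) := by
    rw [htaylor, ← integral_const_mul]
    refine (sq_setIntegral_le (by simp) (hi _ (by fun_prop)) (hi _ (by fun_prop))).trans ?_
    simp only [Real.volume_real_Ioc, sub_zero, zero_le_one, sup_of_le_left, one_mul]
    refine setIntegral_mono_on (hi _ (by fun_prop)) (hi _ (by fun_prop)) measurableSet_Ioc
      fun t ht => (le_trans ?_ (hb₂ (t • u)))
    rw [mul_pow]
    refine mul_le_of_le_one_left (sq_nonneg _) ?_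
    nlinarith [ht.1, ht.2]
  change (F u - S₀ 0 - fderiv ℝ S₀ 0 u) ^ 2 ≤
    2 * (V * K ^ 2) * (Θ u + ∫ s in Set.Ioc (0 : ℝ) 1, Θ (s • u))
  rw [hf₀]
  nlinarith [sq_nonneg ((S₀ u - F u) + (S₀ u - S₀ 0 - S₁ 0))]

theorem mollify_eq_integral_rescaled (d : ℕ) (ψ f : EuclideanSpace ℝ (Fin d) → ℝ) {r : ℝ}
    (hr : 0 < r) (x : EuclideanSpace ℝ (Fin d)) :
    mollify d ψ f r = fun y => ∫ t, f (x + r • t) * ψ (r⁻¹ • (y - x) - t) := by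
  ext y
  have h1 := Measure.integral_comp_smul volume
    (fun t => f (x + t) * ψ (r⁻¹ • (y - x) - r⁻¹ • t)) r
  have h2 := integral_add_left_eq_self (μ := volume) (fun t => f t * ψ (r⁻¹ • (y - t))) x
  simp only [inv_smul_smul₀ hr.ne'] at h1
  have h3 : ∀ t, r⁻¹ • (y - x) - r⁻¹ • t = r⁻¹ • (y - (x + t)) := fun t => by
    rw [← smul_sub, sub_sub]
  simp only [h3] at h1
  rw [h1, h2, smul_eq_mul, mollify, ← integral_const_mul]
  congr 1
  ext t
  rw [finrank_euclideanSpace_fin, abs_of_pos (by positivity), Real.rpow_neg hr.le,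
    Real.rpow_natCast]
  ring

theorem exists_sq_sub_mollify_taylor_le (d : ℕ) {ψ : EuclideanSpace ℝ (Fin d) → ℝ}
    (hψ : ContDiff ℝ 2 ψ) (hψc : HasCompactSupport ψ) (heven : ∀ w, ψ (-w) = ψ w)
    (hint : ∫ w, ψ w = 1) :
    ∃ C ρ : ℝ, 0 < C ∧ 0 < ρ ∧ ∀ f : EuclideanSpace ℝ (Fin d) → ℝ, Continuous f → ∀ r, 0 < r →
      ∀ x v, ‖v‖ ≤ r →
      (f (x + v) - mollify d ψ f r x - ⟪gradient (mollify d ψ f r) x, v⟫) ^ 2 ≤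
        C * ((∫ w in closedBall 0 ρ, secDiff f (x + v) (r • w) ^ 2) +
          ∫ s in Set.Ioc (0 : ℝ) 1, ∫ w in closedBall 0 ρ, secDiff f (x + s • v) (r • w) ^ 2) := by
  obtain ⟨C, ρ, hC, hρ, h⟩ := exists_sq_sub_taylor_le hψ hψc heven hint
  refine ⟨C, ρ, hC, hρ, fun f hf r hr x v hv => ?_⟩
  set F : EuclideanSpace ℝ (Fin d) → ℝ := fun t => f (x + r • t) with hF
  have hFc : Continuous F := by fun_prop
  have hru : r • r⁻¹ • v = v := smul_inv_smul₀ hr.ne' v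
  have hrs : ∀ s : ℝ, r • s • r⁻¹ • v = s • v := fun s => by rw [smul_comm, hru]
  have hu : ‖r⁻¹ • v‖ ≤ 1 := by
    rw [norm_smul, norm_inv, Real.norm_of_nonneg hr.le, inv_mul_le_iff₀ hr, mul_one]
    exact hv
  have key := h F hFc (r⁻¹ • v) hu
  obtain ⟨D, hD, -⟩ := hasFDerivAt_integral_mul_sub hFc (hψ.of_le one_le_two) hψc 0
  have hm := mollify_eq_integral_rescaled d ψ f hr x
  have hmx : mollify d ψ f r x = ∫ t, F t * ψ (0 - t) := by
    simp only [hm, hF, sub_self, smul_zero]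
  have hgrad : ⟪gradient (mollify d ψ f r) x, v⟫ = D (r⁻¹ • v) := by
    have h1 : HasFDerivAt (fun y : EuclideanSpace ℝ (Fin d) => r⁻¹ • (y - x))
        (r⁻¹ • ContinuousLinearMap.id ℝ _) x := ((hasFDerivAt_id x).sub_const x).const_smul r⁻¹
    have h2 : r⁻¹ • (x - x) = 0 := by rw [sub_self, smul_zero]
    rw [← h2] at hD
    have h3 := hD.comp x h1
    rw [gradient, InnerProductSpace.toDual_symm_apply, hm]
    change fderiv ℝ ((fun y => ∫ t, F t * ψ (y - t)) ∘ fun y => r⁻¹ • (y - x)) x v = _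
    rw [h3.fderiv]
    rfl
  have hsec : ∀ u w, secDiff F u w = secDiff f (x + r • u) (r • w) := by
    intro u w
    simp only [secDiff, hF, smul_add, smul_sub, add_assoc, add_sub_assoc]
  rw [hD.fderiv] at key
  simp only [hsec, hrs, hru] at key
  rw [hmx, hgrad]
  simpa only [hF, hru] using key

theorem continuous_add_integral_segment {E : Type*} [NormedAddCommGroup E] [NormedSpace ℝ E]
    [FiniteDimensional ℝ E]
    {Θ : E → ℝ} (hΘ : Continuous Θ) :
    Continuous fun p : E × E => Θ (p.1 + p.2) + ∫ s in Set.Ioc (0 : ℝ) 1, Θ (p.1 + s • p.2) := by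
  have := FiniteDimensional.proper_real E
  refine Continuous.add (by fun_prop) ?_
  simp_rw [← integral_Icc_eq_integral_Ioc]
  exact continuous_parametric_integral_of_continuous
    (f := fun (p : E × E) (s : ℝ) => Θ (p.1 + s • p.2)) (by unfold Function.uncurry; fun_prop)
    isCompact_Icc

section

variable {E : Type*} [NormedAddCommGroup E] [InnerProductSpace ℝ E] [FiniteDimensional ℝ E]
  [MeasurableSpace E] [BorelSpace E]

theorem setIntegral_ball_add_integral_segment_le {Θ : E → ℝ} (hΘ : Continuous Θ)
    (hΘ0 : ∀ y, 0 ≤ Θ y) {r R : ℝ} (hrR : r ≤ R) (z : E) :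
    ∫ x in ball z R, ∫ v in closedBall (0 : E) r,
        (Θ (x + v) + ∫ s in Set.Ioc (0 : ℝ) 1, Θ (x + s • v)) ≤
      2 * volume.real (closedBall (0 : E) r) * ∫ y in ball z (2 * R), Θ y := by
  have hQ := continuous_add_integral_segment hΘ
  have hK := isCompact_closedBall (0 : E) r
  set B := ∫ y in ball z (2 * R), Θ y
  rw [setIntegral_setIntegral_swap_of_continuous
    (k := fun (x v : E) => Θ (x + v) + ∫ s in Set.Ioc (0 : ℝ) 1, Θ (x + s • v)) hQ
    (isCompact_closedBall z R) hK ball_subset_closedBall le_rfl]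
  have hv : ∀ v ∈ closedBall (0 : E) r, ∫ x in ball z R,
      (Θ (x + v) + ∫ s in Set.Ioc (0 : ℝ) 1, Θ (x + s • v)) ≤ 2 * B := by
    intro v hv
    rw [mem_closedBall_zero_iff] at hv
    have hc : Continuous fun x => ∫ s in Set.Ioc (0 : ℝ) 1, Θ (x + s • v) := by
      simp_rw [← integral_Icc_eq_integral_Ioc]
      exact continuous_parametric_integral_of_continuous
        (f := fun (x : E) (s : ℝ) => Θ (x + s • v)) (by unfold Function.uncurry; fun_prop)
        isCompact_Icc
    rw [integral_add (Continuous.integrableOn_ball (by fun_prop) _ _) (hc.integrableOn_ball _ _),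
      setIntegral_setIntegral_swap_of_continuous (k := fun (x : E) (s : ℝ) => Θ (x + s • v))
        (by unfold Function.uncurry; fun_prop) (isCompact_closedBall z R) isCompact_Icc
        ball_subset_closedBall Set.Ioc_subset_Icc_self]
    have h1 : ∫ x in ball z R, Θ (x + v) ≤ B :=
      setIntegral_ball_comp_add_le hΘ hΘ0 z v (by linarith)
    have h2 : ∫ s in Set.Ioc (0 : ℝ) 1, ∫ x in ball z R, Θ (x + s • v) ≤
        ∫ _ in Set.Ioc (0 : ℝ) 1, B := by
      have hnn : ∀ s : ℝ, (0 : ℝ) ≤ ∫ x in ball z R, Θ (x + s • v) :=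
        fun s => integral_nonneg fun x => hΘ0 _
      refine integral_mono_of_nonneg (μ := volume.restrict (Set.Ioc (0 : ℝ) 1))
        (ae_of_all _ hnn) (integrable_const _)
        ((ae_restrict_iff' measurableSet_Ioc).2 (ae_of_all _ fun s hs => ?_))
      refine setIntegral_ball_comp_add_le hΘ hΘ0 z (s • v) ?_
      rw [norm_smul, Real.norm_of_nonneg hs.1.le]
      nlinarith [norm_nonneg v, hs.2]
    rw [setIntegral_const, Real.volume_real_Ioc, smul_eq_mul] at h2
    norm_num at h2
    linarith
  calc _ ≤ ∫ _ in closedBall (0 : E) r, 2 * B := by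
        refine integral_mono_of_nonneg (ae_of_all _ fun v => ?_)
          (integrableOn_const hK.measure_ne_top)
          ((ae_restrict_iff' hK.measurableSet).2 (ae_of_all _ hv))
        exact integral_nonneg fun x => add_nonneg (hΘ0 _) (integral_nonneg fun s => hΘ0 _)
    _ = _ := by rw [setIntegral_const, smul_eq_mul]; ring

theorem setIntegral_ball_integral_sq_secDiff_le {f : E → ℝ} (hf : Continuous f) {R : ℝ} (hR : 0 < R)
    (r ρ : ℝ) (z : E) :
    ∫ y in ball z (2 * R), ∫ w in closedBall (0 : E) ρ, secDiff f y (r • w) ^ 2 ≤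
      ∫ w in closedBall (0 : E) ρ, ∫ x, tent z R x * secDiff f x (r • w) ^ 2 := by
  have hK := isCompact_closedBall (0 : E) ρ
  have hs : Continuous fun p : E × E => secDiff f p.1 (r • p.2) ^ 2 := by
    unfold secDiff
    fun_prop
  rw [setIntegral_setIntegral_swap_of_continuous (k := fun y w : E => secDiff f y (r • w) ^ 2) hs
    (isCompact_closedBall z (2 * R)) hK ball_subset_closedBall le_rfl]
  have hc : Continuous fun w => ∫ x, tent z R x * secDiff f x (r • w) ^ 2 :=
    continuous_integral_tent_mul hR z (k := fun w x => secDiff f x (r • w) ^ 2)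
      (by unfold Function.uncurry secDiff; fun_prop)
  refine integral_mono_of_nonneg (ae_of_all _ fun w => integral_nonneg fun x => sq_nonneg _)
    (hc.continuousOn.integrableOn_compact hK) (ae_of_all _ fun w => ?_)
  have hw : Continuous fun x => secDiff f x (r • w) ^ 2 := by unfold secDiff; fun_prop
  have hi := integrable_tent_mul hR z hw
  calc ∫ x in ball z (2 * R), secDiff f x (r • w) ^ 2
      ≤ ∫ x in ball z (2 * R), tent z R x * secDiff f x (r • w) ^ 2 :=
        setIntegral_mono_on (hw.integrableOn_ball _ _) hi.integrableOn measurableSet_ball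
          fun x hx => le_mul_of_one_le_left (sq_nonneg _) (one_le_tent hR hx)
    _ ≤ _ := setIntegral_le_integral hi
        (ae_of_all _ fun x => mul_nonneg (tent_nonneg z R x) (sq_nonneg _))

end

theorem sq_nu1bar_le (d : ℕ) {ψ f : EuclideanSpace ℝ (Fin d) → ℝ} (hf : Continuous f)
    {Q : EuclideanSpace ℝ (Fin d) → ℝ} (hQ : Continuous Q) {C r : ℝ} (hC : 0 ≤ C) (hr : 0 < r)
    (hQ0 : ∀ v, 0 ≤ Q v) {x : EuclideanSpace ℝ (Fin d)}
    (h : ∀ v, ‖v‖ ≤ r →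
      (f (x + v) - mollify d ψ f r x - ⟪gradient (mollify d ψ f r) x, v⟫) ^ 2 ≤ C * Q v) :
    nu1bar d ψ f x r ^ 2 ≤
      C * (r ^ 2)⁻¹ * (volume.real (closedBall (0 : EuclideanSpace ℝ (Fin d)) r))⁻¹ *
        ∫ v in closedBall 0 r, Q v := by
  have hV : volume.real (ball x r) =
      volume.real (closedBall (0 : EuclideanSpace ℝ (Fin d)) r) := by
    rw [measureReal_def, measureReal_def, Measure.addHaar_closedBall _ _ hr.le,
      Measure.addHaar_ball_of_pos _ _ hr]
  rw [nu1bar, setAverage_eq, hV, smul_eq_mul, Real.sq_sqrt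
    (mul_nonneg (by positivity) (integral_nonneg fun y => sq_nonneg _)),
    mul_comm (C * _), mul_assoc]
  refine mul_le_mul_of_nonneg_left ?_ (by positivity)
  set m := mollify d ψ f r x
  set G := gradient (mollify d ψ f r) x
  have hpre : (fun v => x + v) ⁻¹' ball x r = ball 0 r := by
    ext v; simp
  rw [← (measurePreserving_add_left volume x).setIntegral_preimage_emb
    (measurableEmbedding_addLeft x), hpre, ← integral_const_mul]
  simp only [add_sub_cancel_left]
  have hg : Continuous fun v => ((f (x + v) - m - ⟪G, v⟫) / r) ^ 2 :=
    ((((hf.comp (continuous_const_add x)).sub continuous_const).sub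
      (continuous_const.inner continuous_id)).div_const r).pow 2
  have hi : IntegrableOn (fun v => C * (r ^ 2)⁻¹ * Q v) (closedBall 0 r) :=
    (Continuous.continuousOn (by fun_prop)).integrableOn_compact (isCompact_closedBall 0 r)
  refine (setIntegral_mono_on (hg.integrableOn_ball _ _)
    (hi.mono_set ball_subset_closedBall) measurableSet_ball fun v hv => ?_).trans
    (setIntegral_mono_set hi (ae_of_all _ fun v => mul_nonneg (by positivity) (hQ0 v))
      ball_subset_closedBall.eventuallyLE)
  rw [div_pow, div_eq_inv_mul, mul_right_comm, mul_comm (C * _)]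
  exact mul_le_mul_of_nonneg_left (h v (mem_ball_zero_iff.1 hv).le) (by positivity)

theorem exists_lintegral_ball_sq_nu1bar_le (d : ℕ) {ψ : EuclideanSpace ℝ (Fin d) → ℝ}
    (hψ : ContDiff ℝ 2 ψ) (hψc : HasCompactSupport ψ) (heven : ∀ w, ψ (-w) = ψ w)
    (hint : ∫ w, ψ w = 1) :
    ∃ C ρ : ℝ, 0 < C ∧ 0 < ρ ∧ ∀ f : EuclideanSpace ℝ (Fin d) → ℝ, Continuous f →
      ∀ z r R, 0 < r → r ≤ R →
      ∫⁻ x in ball z R, ENNReal.ofReal (nu1bar d ψ f x r ^ 2) ≤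
        ENNReal.ofReal (C * ((r ^ 2)⁻¹ *
          ∫ w in closedBall 0 ρ, ∫ x, tent z R x * secDiff f x (r • w) ^ 2)) := by
  obtain ⟨C, ρ, hC, hρ, h⟩ := exists_sq_sub_mollify_taylor_le d hψ hψc heven hint
  refine ⟨2 * C, ρ, by positivity, hρ, fun f hf z r R hr hrR => ?_⟩
  set V := volume.real (closedBall (0 : EuclideanSpace ℝ (Fin d)) r) with hV
  have hVpos : 0 < V := by
    rw [hV, Measure.addHaar_real_closedBall _ _ hr.le]
    exact mul_pos (by positivity) (ENNReal.toReal_pos (measure_ball_pos _ _ one_pos).ne'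
      measure_ball_lt_top.ne)
  have hK := isCompact_closedBall (0 : EuclideanSpace ℝ (Fin d))
  set Θ : EuclideanSpace ℝ (Fin d) → ℝ :=
    fun y => ∫ w in closedBall (0 : EuclideanSpace ℝ (Fin d)) ρ, secDiff f y (r • w) ^ 2 with hΘdef
  have hΘ : Continuous Θ :=
    continuous_parametric_integral_of_continuous
      (f := fun y (w : EuclideanSpace ℝ (Fin d)) => secDiff f y (r • w) ^ 2)
      (by unfold Function.uncurry secDiff; fun_prop) (hK ρ)
  have hΘ0 : ∀ y, 0 ≤ Θ y := fun y => integral_nonneg fun w => sq_nonneg _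
  set Q : EuclideanSpace ℝ (Fin d) → EuclideanSpace ℝ (Fin d) → ℝ :=
    fun x v => Θ (x + v) + ∫ s in Set.Ioc (0 : ℝ) 1, Θ (x + s • v) with hQdef
  have hQ : Continuous Q.uncurry := continuous_add_integral_segment hΘ
  have hQ0 : ∀ x v, 0 ≤ Q x v := fun x v =>
    add_nonneg (hΘ0 _) (integral_nonneg fun s => hΘ0 _)
  set T : EuclideanSpace ℝ (Fin d) → ℝ :=
    fun x => C * (r ^ 2)⁻¹ * V⁻¹ * ∫ v in closedBall 0 r, Q x v with hTdef
  have hT : Continuous T :=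
    continuous_const.mul (continuous_parametric_integral_of_continuous hQ (hK r))
  have hT0 : ∀ x, 0 ≤ T x := fun x => mul_nonneg (by positivity) (integral_nonneg (hQ0 x))
  calc ∫⁻ x in ball z R, ENNReal.ofReal (nu1bar d ψ f x r ^ 2)
      ≤ ∫⁻ x in ball z R, ENNReal.ofReal (T x) :=
        lintegral_mono fun x => ENNReal.ofReal_le_ofReal <|
          sq_nu1bar_le d hf (hQ.comp (Continuous.prodMk_right x)) hC.le hr (hQ0 x) (h f hf r hr x)
    _ = ENNReal.ofReal (∫ x in ball z R, T x) :=
        (ofReal_integral_eq_lintegral_ofReal (hT.integrableOn_ball _ _) (ae_of_all _ hT0)).symm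
    _ ≤ _ := by
        refine ENNReal.ofReal_le_ofReal ?_
        rw [hTdef, integral_const_mul]
        have h1 := setIntegral_ball_add_integral_segment_le hΘ hΘ0 hrR z
        have h2 := setIntegral_ball_integral_sq_secDiff_le hf (hr.trans_le hrR) r ρ z
        calc _ ≤ C * (r ^ 2)⁻¹ * V⁻¹ * (2 * V * ∫ w in closedBall 0 ρ,
                ∫ x, tent z R x * secDiff f x (r • w) ^ 2) := by
              refine mul_le_mul_of_nonneg_left (h1.trans ?_) (by positivity)
              exact mul_le_mul_of_nonneg_left h2 (by positivity)
          _ = _ := by field_simp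

/-- If `f` is `C¹` with `‖∇f‖_* ≤ M` (BMO gradient), then the `α = 1`
square function estimate `∫_0^R ∫_{B_R(z)} ν̄₁^f(x,r)² dx dr/r ≤ C M² R^d` holds with `C`
depending only on `d` and the mollifier `ψ`. -/
theorem bmo_gradient_implies_nu1bar_square_function (d : ℕ) (hd : 0 < d)
    (ψ : EuclideanSpace ℝ (Fin d) → ℝ) (hψs : ContDiff ℝ (⊤ : ℕ∞) ψ)
    (hψc : HasCompactSupport ψ)
    (hψrad : ∀ x y : EuclideanSpace ℝ (Fin d), ‖x‖ = ‖y‖ → ψ x = ψ y)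
    (hψ0 : ∀ x, 0 ≤ ψ x) (hψint : ∫ x, ψ x = 1) :
    ∃ C : ℝ, 0 < C ∧
      ∀ (M : ℝ) (f : EuclideanSpace ℝ (Fin d) → ℝ), 0 ≤ M →
        ContDiff ℝ 1 f →
        (∀ (x : EuclideanSpace ℝ (Fin d)) (r : ℝ), 0 < r →
          ⨍ y in ball x r, ‖gradient f y - ⨍ w in ball x r, gradient f w‖ ≤ M) →
        ∀ (z : EuclideanSpace ℝ (Fin d)) (R : ℝ), 0 < R →
          (∫⁻ r in Set.Ioo (0 : ℝ) R,
            (∫⁻ x in ball z R,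
              ENNReal.ofReal ((nu1bar d ψ f x r) ^ 2)) / ENNReal.ofReal r)
            ≤ ENNReal.ofReal (C * M ^ 2 * R ^ (d : ℕ)) := by
  obtain ⟨C, ρ, hC, hρ, h⟩ := exists_lintegral_ball_sq_nu1bar_le d
    (hψs.of_le (WithTop.coe_le_coe.2 le_top)) hψc (fun w => hψrad _ _ (norm_neg w)) hψint
  obtain ⟨C', hC', h'⟩ := exists_lintegral_integral_sq_secDiff_le_of_bmo d hρ
  refine ⟨C * C', by positivity, fun M f hM hf hbmo z R hR => ?_⟩
  calc _ ≤ ∫⁻ r in Set.Ioo 0 R, ENNReal.ofReal C * ENNReal.ofReal ((r ^ 2)⁻¹ *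
        (∫ w in closedBall 0 ρ, ∫ x, tent z R x * secDiff f x (r • w) ^ 2) / r) := by
        refine setLIntegral_mono' measurableSet_Ioo fun r hr => ?_
        rw [← ENNReal.ofReal_mul hC.le, ← mul_div_assoc, ENNReal.ofReal_div_of_pos hr.1]
        exact ENNReal.div_le_div_right (h f hf.continuous z r R hr.1 hr.2.le) _
    _ = ENNReal.ofReal C * ∫⁻ r in Set.Ioo 0 R, ENNReal.ofReal ((r ^ 2)⁻¹ *
        (∫ w in closedBall 0 ρ, ∫ x, tent z R x * secDiff f x (r • w) ^ 2) / r) :=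
        lintegral_const_mul' _ _ ENNReal.ofReal_ne_top
    _ ≤ ENNReal.ofReal C * ENNReal.ofReal (C' * M ^ 2 * R ^ d) := by
        gcongr
        exact h' M f hM hf hbmo z R hR
    _ = _ := by rw [← ENNReal.ofReal_mul hC.le]; ring_nf
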